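/- Let M be a countable model of IΔ0. For each n ∈ ℕ, M satisfies IΣ_{n+2} if and only if M admits a proper Σ_{n+2}-elementary end extension K with K ⊨ M-IΣ_{n+1}. -/

import Mathlib

namespace PaperArith

/-! ## Syntax of (two-sorted) first-order arithmetic

Terms and formulas of arithmetic in the language `{0, 1, +, ·, <}`,
with number variables and (monadic second-order) set variables both indexed
by natural numbers.  Bounded quantifiers are taken as primitives, so that the
class `Δ₀` of bounded formulas is a purely syntactic class. -/

/-- Terms of first-order arithmetic in the language `{0, 1, +, ·, <}`. -/
inductive Term : Type
  | var : ℕ → Term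
  | zero : Term
  | one : Term
  | add : Term → Term → Term
  | mul : Term → Term → Term

/-- Formulas of (two-sorted) arithmetic.  `mem t i` is the atomic formula
`t ∈ Xᵢ`; `ball x t φ` is `∀ x < t, φ` and `bex x t φ` is `∃ x < t, φ`;
`sall i φ` and `sex i φ` quantify over the set variable `Xᵢ`.
Purely first-order formulas are those avoiding `mem`, `sall`, `sex`. -/
inductive Fml : Type
  | eq : Term → Term → Fml
  | lt : Term → Term → Fml
  | mem : Term → ℕ → Fml
  | not : Fml → Fml
  | and : Fml → Fml → Fml
  | or : Fml → Fml → Fml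
  | imp : Fml → Fml → Fml
  | all : ℕ → Fml → Fml
  | ex : ℕ → Fml → Fml
  | ball : ℕ → Term → Fml → Fml
  | bex : ℕ → Term → Fml → Fml
  | sall : ℕ → Fml → Fml
  | sex : ℕ → Fml → Fml

/-- A structure for the first-order language of arithmetic. -/
structure Str : Type 1 where
  M : Type
  zero : M
  one : M
  add : M → M → M
  mul : M → M → M
  lt : M → M → Prop

/-- Value of a term under a valuation of the number variables. -/
def tval (S : Str) (v : ℕ → S.M) : Term → S.M
  | .var i => v i
  | .zero => S.zero
  | .one => S.one
  | .add t u => S.add (tval S v t) (tval S v u)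
  | .mul t u => S.mul (tval S v t) (tval S v u)

/-- Update a valuation at one variable. -/
def upd {α : Type} (v : ℕ → α) (x : ℕ) (a : α) : ℕ → α :=
  fun i => if i = x then a else v i

/-- Tarskian satisfaction over the structure `S`, with second-order universe
`X` (set quantifiers range over `X`); `v` is the valuation of number
variables, `w` the valuation of set variables. -/
def Sat (S : Str) (X : Set (Set S.M)) : (ℕ → S.M) → (ℕ → Set S.M) → Fml → Prop
  | v, _, .eq t u => tval S v t = tval S v u
  | v, _, .lt t u => S.lt (tval S v t) (tval S v u)
  | v, w, .mem t i => tval S v t ∈ w i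
  | v, w, .not φ => ¬ Sat S X v w φ
  | v, w, .and φ ψ => Sat S X v w φ ∧ Sat S X v w ψ
  | v, w, .or φ ψ => Sat S X v w φ ∨ Sat S X v w ψ
  | v, w, .imp φ ψ => Sat S X v w φ → Sat S X v w ψ
  | v, w, .all x φ => ∀ m : S.M, Sat S X (upd v x m) w φ
  | v, w, .ex x φ => ∃ m : S.M, Sat S X (upd v x m) w φ
  | v, w, .ball x t φ => ∀ m : S.M, S.lt m (tval S v t) → Sat S X (upd v x m) w φ
  | v, w, .bex x t φ => ∃ m : S.M, S.lt m (tval S v t) ∧ Sat S X (upd v x m) w φ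
  | v, w, .sall i φ => ∀ A : Set S.M, A ∈ X → Sat S X v (upd w i A) φ
  | v, w, .sex i φ => ∃ A : Set S.M, A ∈ X ∧ Sat S X v (upd w i A) φ

/-- First-order satisfaction (for purely first-order formulas the second-order
data is irrelevant). -/
def Sat0 (S : Str) (v : ℕ → S.M) (φ : Fml) : Prop :=
  Sat S ∅ v (fun _ => ∅) φ

/-! ## The arithmetic hierarchy -/

/-- `Δ₀` formulas: purely first-order, only bounded quantifiers. -/
inductive Delta0 : Fml → Prop
  | eq (t u : Term) : Delta0 (.eq t u)
  | lt (t u : Term) : Delta0 (.lt t u)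
  | not {φ : Fml} : Delta0 φ → Delta0 (.not φ)
  | and {φ ψ : Fml} : Delta0 φ → Delta0 ψ → Delta0 (.and φ ψ)
  | or {φ ψ : Fml} : Delta0 φ → Delta0 ψ → Delta0 (.or φ ψ)
  | imp {φ ψ : Fml} : Delta0 φ → Delta0 ψ → Delta0 (.imp φ ψ)
  | ball (x : ℕ) (t : Term) {φ : Fml} : Delta0 φ → Delta0 (.ball x t φ)
  | bex (x : ℕ) (t : Term) {φ : Fml} : Delta0 φ → Delta0 (.bex x t φ)

mutual
  /-- `Σₙ` formulas of the first-order arithmetic hierarchy. -/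
  inductive IsSigma : ℕ → Fml → Prop
    | delta0 {n : ℕ} {φ : Fml} : Delta0 φ → IsSigma n φ
    | ofPi {n : ℕ} {φ : Fml} : IsPi n φ → IsSigma (n + 1) φ
    | ex (x : ℕ) {n : ℕ} {φ : Fml} : IsSigma (n + 1) φ → IsSigma (n + 1) (.ex x φ)
  /-- `Πₙ` formulas of the first-order arithmetic hierarchy. -/
  inductive IsPi : ℕ → Fml → Prop
    | delta0 {n : ℕ} {φ : Fml} : Delta0 φ → IsPi n φ
    | ofSigma {n : ℕ} {φ : Fml} : IsSigma n φ → IsPi (n + 1) φ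
    | all (x : ℕ) {n : ℕ} {φ : Fml} : IsPi (n + 1) φ → IsPi (n + 1) (.all x φ)
end

/-- `Σ₀(Σₙ)`: the closure of `Σₙ` under Boolean operations and bounded
quantification. -/
inductive Sigma0Sigma (n : ℕ) : Fml → Prop
  | ofSigma {φ : Fml} : IsSigma n φ → Sigma0Sigma n φ
  | not {φ : Fml} : Sigma0Sigma n φ → Sigma0Sigma n (.not φ)
  | and {φ ψ : Fml} : Sigma0Sigma n φ → Sigma0Sigma n ψ → Sigma0Sigma n (.and φ ψ)
  | or {φ ψ : Fml} : Sigma0Sigma n φ → Sigma0Sigma n ψ → Sigma0Sigma n (.or φ ψ)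
  | imp {φ ψ : Fml} : Sigma0Sigma n φ → Sigma0Sigma n ψ → Sigma0Sigma n (.imp φ ψ)
  | ball (x : ℕ) (t : Term) {φ : Fml} : Sigma0Sigma n φ → Sigma0Sigma n (.ball x t φ)
  | bex (x : ℕ) (t : Term) {φ : Fml} : Sigma0Sigma n φ → Sigma0Sigma n (.bex x t φ)

/-- The class `Σₙ ∧ Πₙ` of conjunctions of a `Σₙ` and a `Πₙ` formula. -/
def SigmaAndPi (n : ℕ) (φ : Fml) : Prop :=
  ∃ ψ χ : Fml, IsSigma n ψ ∧ IsPi n χ ∧ φ = Fml.and ψ χ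

/-- The class `Σₙ ∨ Πₙ` of disjunctions of a `Σₙ` and a `Πₙ` formula. -/
def SigmaOrPi (n : ℕ) (φ : Fml) : Prop :=
  ∃ ψ χ : Fml, IsSigma n ψ ∧ IsPi n χ ∧ φ = Fml.or ψ χ

/-- `Δ₀⁰` formulas of second-order arithmetic: only bounded first-order
quantifiers; free set variables (set parameters) are allowed. -/
inductive Delta0SO : Fml → Prop
  | eq (t u : Term) : Delta0SO (.eq t u)
  | lt (t u : Term) : Delta0SO (.lt t u)
  | mem (t : Term) (i : ℕ) : Delta0SO (.mem t i)
  | not {φ : Fml} : Delta0SO φ → Delta0SO (.not φ)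
  | and {φ ψ : Fml} : Delta0SO φ → Delta0SO ψ → Delta0SO (.and φ ψ)
  | or {φ ψ : Fml} : Delta0SO φ → Delta0SO ψ → Delta0SO (.or φ ψ)
  | imp {φ ψ : Fml} : Delta0SO φ → Delta0SO ψ → Delta0SO (.imp φ ψ)
  | ball (x : ℕ) (t : Term) {φ : Fml} : Delta0SO φ → Delta0SO (.ball x t φ)
  | bex (x : ℕ) (t : Term) {φ : Fml} : Delta0SO φ → Delta0SO (.bex x t φ)

mutual
  /-- `Σₙ⁰` formulas of the second-order arithmetic hierarchy
  (set parameters allowed, no set quantifiers). -/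
  inductive SigmaSO : ℕ → Fml → Prop
    | delta0 {n : ℕ} {φ : Fml} : Delta0SO φ → SigmaSO n φ
    | ofPi {n : ℕ} {φ : Fml} : PiSO n φ → SigmaSO (n + 1) φ
    | ex (x : ℕ) {n : ℕ} {φ : Fml} : SigmaSO (n + 1) φ → SigmaSO (n + 1) (.ex x φ)
  /-- `Πₙ⁰` formulas of the second-order arithmetic hierarchy. -/
  inductive PiSO : ℕ → Fml → Prop
    | delta0 {n : ℕ} {φ : Fml} : Delta0SO φ → PiSO n φ
    | ofSigma {n : ℕ} {φ : Fml} : SigmaSO n φ → PiSO (n + 1) φ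
    | all (x : ℕ) {n : ℕ} {φ : Fml} : PiSO (n + 1) φ → PiSO (n + 1) (.all x φ)
end

/-! ## First-order theories -/

/-- `PA⁻`: the theory of non-negative parts of discretely ordered rings. -/
structure PAminus (S : Str) : Prop where
  add_assoc : ∀ a b c, S.add (S.add a b) c = S.add a (S.add b c)
  add_comm : ∀ a b, S.add a b = S.add b a
  mul_assoc : ∀ a b c, S.mul (S.mul a b) c = S.mul a (S.mul b c)
  mul_comm : ∀ a b, S.mul a b = S.mul b a
  distrib : ∀ a b c, S.mul a (S.add b c) = S.add (S.mul a b) (S.mul a c)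
  add_zero : ∀ a, S.add a S.zero = a
  mul_zero : ∀ a, S.mul a S.zero = S.zero
  mul_one : ∀ a, S.mul a S.one = a
  lt_irrefl : ∀ a, ¬ S.lt a a
  lt_trans : ∀ a b c, S.lt a b → S.lt b c → S.lt a c
  lt_total : ∀ a b, S.lt a b ∨ a = b ∨ S.lt b a
  add_lt_add : ∀ a b c, S.lt a b → S.lt (S.add a c) (S.add b c)
  mul_lt_mul : ∀ a b c, S.lt a b → S.lt S.zero c → S.lt (S.mul a c) (S.mul b c)
  zero_lt_one : S.lt S.zero S.one
  zero_le : ∀ a, a = S.zero ∨ S.lt S.zero a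
  discrete : ∀ a b, S.lt a b → S.add a S.one = b ∨ S.lt (S.add a S.one) b
  pred : ∀ a, S.lt S.zero a → ∃ b, S.add b S.one = a
  sub : ∀ a b, S.lt a b → ∃ c, S.add a c = b

/-- The induction scheme for the class `Γ` of formulas
(parameters are allowed via the ambient valuation `v`). -/
def IndFor (S : Str) (Γ : Fml → Prop) : Prop :=
  ∀ φ : Fml, Γ φ → ∀ (v : ℕ → S.M) (x : ℕ),
    Sat0 S (upd v x S.zero) φ →
    (∀ m, Sat0 S (upd v x m) φ → Sat0 S (upd v x (S.add m S.one)) φ) →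
    ∀ m, Sat0 S (upd v x m) φ

/-- The collection scheme for the class `Γ`:
`(∀ x < a ∃ y φ) → (∃ b ∀ x < a ∃ y < b φ)`. -/
def CollFor (S : Str) (Γ : Fml → Prop) : Prop :=
  ∀ φ : Fml, Γ φ → ∀ (v : ℕ → S.M) (x y : ℕ), x ≠ y → ∀ a : S.M,
    (∀ m, S.lt m a → ∃ k, Sat0 S (upd (upd v x m) y k) φ) →
    ∃ b, ∀ m, S.lt m a → ∃ k, S.lt k b ∧ Sat0 S (upd (upd v x m) y k) φ

/-- `IΔ₀` (over `PA⁻`). -/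
def IDelta0 (S : Str) : Prop := PAminus S ∧ IndFor S Delta0

/-- `IΣₙ` (over `PA⁻`; note `Δ₀ ⊆ Σₙ`, so this includes `IΔ₀`). -/
def ISigma (S : Str) (n : ℕ) : Prop := PAminus S ∧ IndFor S (IsSigma n)

/-- `BΣₙ`: the `Σₙ`-collection scheme, including `IΔ₀` (over `PA⁻`). -/
def BSigma (S : Str) (n : ℕ) : Prop := IDelta0 S ∧ CollFor S (IsSigma n)

/-- The weak regularity principle `WRφ` for all `φ` in the class `Γ`:
the universal closure of `(∀ x ∃ y < a φ(x,y)) → (∃ y < a ∀ b ∃ x > b φ(x,y))`.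
Here `x, y` are the two displayed variables and all other free variables of
`φ` are parameters, interpreted by the ambient valuation `v`. -/
def WRFor (S : Str) (Γ : Fml → Prop) : Prop :=
  ∀ φ : Fml, Γ φ → ∀ (v : ℕ → S.M) (x y : ℕ), x ≠ y → ∀ a : S.M,
    (∀ m, ∃ k, S.lt k a ∧ Sat0 S (upd (upd v x m) y k) φ) →
    ∃ k, S.lt k a ∧ ∀ b, ∃ m, S.lt b m ∧ Sat0 S (upd (upd v x m) y k) φ

/-! ## Second-order theories -/

/-- Second-order induction scheme for the class `Γ`, with set parameters
from the second-order universe `X`. -/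
def IndForSO (S : Str) (X : Set (Set S.M)) (Γ : Fml → Prop) : Prop :=
  ∀ φ : Fml, Γ φ → ∀ (v : ℕ → S.M) (w : ℕ → Set S.M), (∀ i, w i ∈ X) → ∀ x : ℕ,
    Sat S X (upd v x S.zero) w φ →
    (∀ m, Sat S X (upd v x m) w φ → Sat S X (upd v x (S.add m S.one)) w φ) →
    ∀ m, Sat S X (upd v x m) w φ

/-- Second-order collection scheme for the class `Γ`. -/
def CollForSO (S : Str) (X : Set (Set S.M)) (Γ : Fml → Prop) : Prop :=
  ∀ φ : Fml, Γ φ → ∀ (v : ℕ → S.M) (w : ℕ → Set S.M), (∀ i, w i ∈ X) →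
    ∀ (x y : ℕ), x ≠ y → ∀ a : S.M,
    (∀ m, S.lt m a → ∃ k, Sat S X (upd (upd v x m) y k) w φ) →
    ∃ b, ∀ m, S.lt m a → ∃ k, S.lt k b ∧ Sat S X (upd (upd v x m) y k) w φ

/-- `Δ₁⁰`-comprehension. -/
def Delta1CA (S : Str) (X : Set (Set S.M)) : Prop :=
  ∀ φ ψ : Fml, SigmaSO 1 φ → PiSO 1 ψ →
    ∀ (v : ℕ → S.M) (w : ℕ → Set S.M), (∀ i, w i ∈ X) → ∀ x : ℕ,
    (∀ m, Sat S X (upd v x m) w φ ↔ Sat S X (upd v x m) w ψ) →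
    ∃ A ∈ X, ∀ m, m ∈ A ↔ Sat S X (upd v x m) w φ

/-- `Σₙ`-comprehension for first-order formulas with parameters from `M`. -/
def SigmaCA (S : Str) (X : Set (Set S.M)) (n : ℕ) : Prop :=
  ∀ φ : Fml, IsSigma n φ → ∀ (v : ℕ → S.M) (x : ℕ),
    ∃ A ∈ X, ∀ m, m ∈ A ↔ Sat0 S (upd v x m) φ

/-- `RCA₀`. -/
def RCA0 (S : Str) (X : Set (Set S.M)) : Prop :=
  PAminus S ∧ IndForSO S X (SigmaSO 1) ∧ Delta1CA S X

/-- `Σ₁⁰`-separation; over `RCA₀` this is equivalent to weak Kőnig's lemma. -/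
def Sigma1Sep (S : Str) (X : Set (Set S.M)) : Prop :=
  ∀ φ ψ : Fml, SigmaSO 1 φ → SigmaSO 1 ψ →
    ∀ (v : ℕ → S.M) (w : ℕ → Set S.M), (∀ i, w i ∈ X) → ∀ x : ℕ,
    (∀ m, ¬ (Sat S X (upd v x m) w φ ∧ Sat S X (upd v x m) w ψ)) →
    ∃ A ∈ X, ∀ m, (Sat S X (upd v x m) w φ → m ∈ A) ∧ (m ∈ A → ¬ Sat S X (upd v x m) w ψ)

/-- `WKL₀`, rendered as `RCA₀` plus `Σ₁⁰`-separation (which is equivalent,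
over `RCA₀`, to weak Kőnig's lemma). -/
def WKL0 (S : Str) (X : Set (Set S.M)) : Prop := RCA0 S X ∧ Sigma1Sep S X

/-- `BΣₙ⁰`: the second-order `Σₙ⁰`-collection scheme (including `IΔ₀⁰`,
over `PA⁻`). -/
def BSigmaSO (S : Str) (X : Set (Set S.M)) (n : ℕ) : Prop :=
  PAminus S ∧ IndForSO S X Delta0SO ∧ CollForSO S X (SigmaSO n)

/-- `IΣₙ⁰`: the second-order `Σₙ⁰`-induction scheme, over `RCA₀`. -/
def ISigmaSO (S : Str) (X : Set (Set S.M)) (n : ℕ) : Prop :=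
  RCA0 S X ∧ IndForSO S X (SigmaSO n)

/-! ## Exponentiation and binary digits -/

/-- Satisfaction of a three-variable formula `E(x₀, x₁, x₂)` at `(a, b, c)`. -/
def ExpAt (S : Str) (E : Fml) (a b c : S.M) : Prop :=
  Sat0 S (fun i => if i = 0 then a else if i = 1 then b else c) E

/-- `E(x₀,x₁,x₂)` is a `Δ₀` definition of the (total) exponentiation function
`x₀ ^ x₁ = x₂`.  The existence of such an `E` expresses `exp`
(the totality of exponentiation). -/
structure IsExpDef (S : Str) (E : Fml) : Prop where
  delta0 : Delta0 E
  base : ∀ a, ExpAt S E a S.zero S.one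
  total : ∀ a b, ∃ c, ExpAt S E a b c
  unique : ∀ a b c c', ExpAt S E a b c → ExpAt S E a b c' → c = c'
  step : ∀ a b c, ExpAt S E a b c → ExpAt S E a (S.add b S.one) (S.mul c a)

/-- `exp`: the totality of exponentiation (via a `Δ₀` definition of its
graph). -/
def SatExp (S : Str) : Prop := ∃ E : Fml, IsExpDef S E

/-! ## Embeddings, end extensions and elementarity -/

/-- An embedding of arithmetic structures. -/
structure Emb (S K : Str) where
  j : S.M → K.M
  inj : Function.Injective j
  zero : j S.zero = K.zero
  one : j S.one = K.one
  add : ∀ a b, j (S.add a b) = K.add (j a) (j b)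
  mul : ∀ a b, j (S.mul a b) = K.mul (j a) (j b)
  lt_iff : ∀ a b, S.lt a b ↔ K.lt (j a) (j b)

/-- The extension along `e` is an end extension: every element of `K` not in
the image of `M` exceeds every element of `M`. -/
def IsEndExt {S K : Str} (e : Emb S K) : Prop :=
  ∀ b : K.M, b ∉ Set.range e.j → ∀ a : S.M, K.lt (e.j a) b

/-- The extension along `e` is proper. -/
def IsProper {S K : Str} (e : Emb S K) : Prop := ¬ Function.Surjective e.j

/-- The extension along `e` is `Σₙ`-elementary: all `Σₙ` formulas with
parameters from `M` are absolute between `M` and `K`. -/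
def SigmaElem {S K : Str} (e : Emb S K) (n : ℕ) : Prop :=
  ∀ φ : Fml, IsSigma n φ → ∀ v : ℕ → S.M,
    (Sat0 S v φ ↔ Sat0 K (fun i => e.j (v i)) φ)

/-- `K ⊨ M‑IΣₙ` (for an extension `e : M → K`): induction up to any `a ∈ M`
for `Σₙ` formulas with parameters from `K`. -/
def MISigma {S K : Str} (e : Emb S K) (n : ℕ) : Prop :=
  ∀ φ : Fml, IsSigma n φ → ∀ (v : ℕ → K.M) (x : ℕ) (a : S.M),
    Sat0 K (upd v x K.zero) φ →
    (∀ m, K.lt m (e.j a) → (Sat0 K (upd v x m) φ → Sat0 K (upd v x (K.add m K.one)) φ)) →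
    ∀ m, K.lt m (e.j a) → Sat0 K (upd v x m) φ

/-- The `x`-th binary digit of `c ∈ K` is `1`, computed via a `Δ₀` definition
`E` of exponentiation on the ground model `S` (here `x` lies under the image
of `S`): there are `x', p ∈ M` with `j x' = x`, `p = 2 ^ x'`, and `u, v ∈ K`
with `c = u·(2p) + p + v` and `v < p`. -/
def BitVia {S K : Str} (e : Emb S K) (E : Fml) (x c : K.M) : Prop :=
  ∃ x' p : S.M, e.j x' = x ∧ ExpAt S E (S.add S.one S.one) x' p ∧
    ∃ u v : K.M, K.lt v (e.j p) ∧
      c = K.add (K.add (K.mul u (K.add (e.j p) (e.j p))) (e.j p)) v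

/-! ## The second-order restricted ultrapower -/

/-- `A` is cofinal (unbounded) in `S`. -/
def Cofinal (S : Str) (A : Set S.M) : Prop := ∀ b : S.M, ∃ x ∈ A, S.lt b x

/-- The pairing term `⟨x, y⟩ = (x + y)·(x + y) + x`. -/
def pairS (S : Str) (x y : S.M) : S.M := S.add (S.mul (S.add x y) (S.add x y)) x

/-- The graph of `f : M → M`, coded as a subset of `M` via pairing. -/
def graphOf (S : Str) (f : S.M → S.M) : Set S.M := {m | ∃ x, m = pairS S x (f x)}

/-- `f` is a total function `M → M` lying in the second-order universe `X`
(its coded graph belongs to `X`).  The collection of such `f` is the class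
`ℱ` of the restricted ultrapower. -/
def FuncIn (S : Str) (X : Set (Set S.M)) (f : S.M → S.M) : Prop := graphOf S f ∈ X

/-- `U` is an ultrafilter on the Boolean algebra `X`, all of whose elements
are cofinal in `M`. -/
structure UltraOn (S : Str) (X U : Set (Set S.M)) : Prop where
  subset : U ⊆ X
  univ_mem : Set.univ ∈ U
  empty_not_mem : ∅ ∉ U
  inter_mem : ∀ A ∈ U, ∀ B ∈ U, A ∩ B ∈ U
  superset_mem : ∀ A ∈ U, ∀ B ∈ X, A ⊆ B → B ∈ U
  ultra : ∀ A ∈ X, A ∈ U ∨ Aᶜ ∈ U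
  cofinal : ∀ A ∈ U, Cofinal S A

/-- A realization of the second-order restricted ultrapower `ℱ/𝒰` of `S`
with respect to the second-order universe `X` and the ultrafilter `U`:
a structure `K` whose elements are exactly the classes `cls f hf = [f]` of
total functions `f ∈ ℱ`, where `[f] = [g]` iff `f = g` on a set in `U`, with
pointwise arithmetic operations, order decided by `U`, and the inherited
second-order membership relation `memK` serving as the second-order expansion. -/
structure RUP (S : Str) (X U : Set (Set S.M)) : Type 1 where
  K : Str
  cls : (f : S.M → S.M) → FuncIn S X f → K.M
  memK : K.M → Set S.M → Prop
  const_in : ∀ a : S.M, FuncIn S X (fun _ => a)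
  surj : ∀ b : K.M, ∃ (f : S.M → S.M) (hf : FuncIn S X f), cls f hf = b
  eq_iff : ∀ (f : S.M → S.M) (hf : FuncIn S X f) (g : S.M → S.M) (hg : FuncIn S X g),
      (cls f hf = cls g hg) ↔ {i : S.M | f i = g i} ∈ U
  lt_iff : ∀ (f : S.M → S.M) (hf : FuncIn S X f) (g : S.M → S.M) (hg : FuncIn S X g),
      K.lt (cls f hf) (cls g hg) ↔ {i : S.M | S.lt (f i) (g i)} ∈ U
  zero_eq : K.zero = cls (fun _ => S.zero) (const_in S.zero)
  one_eq : K.one = cls (fun _ => S.one) (const_in S.one)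
  add_eq : ∀ (f : S.M → S.M) (hf : FuncIn S X f) (g : S.M → S.M) (hg : FuncIn S X g)
      (h : S.M → S.M) (hh : FuncIn S X h), (∀ i, h i = S.add (f i) (g i)) →
      K.add (cls f hf) (cls g hg) = cls h hh
  mul_eq : ∀ (f : S.M → S.M) (hf : FuncIn S X f) (g : S.M → S.M) (hg : FuncIn S X g)
      (h : S.M → S.M) (hh : FuncIn S X h), (∀ i, h i = S.mul (f i) (g i)) →
      K.mul (cls f hf) (cls g hg) = cls h hh
  mem_iff : ∀ (f : S.M → S.M) (hf : FuncIn S X f) (A : Set S.M), A ∈ X →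
      (memK (cls f hf) A ↔ {i : S.M | f i ∈ A} ∈ U)

/-- The canonical embedding `M → ℱ/𝒰` via constant functions. -/
def RUP.emb {S : Str} {X U : Set (Set S.M)} (R : RUP S X U) (a : S.M) : R.K.M :=
  R.cls (fun _ => a) (R.const_in a)

/-- The subset of `ℱ/𝒰` induced by `A ⊆ M`. -/
def RUP.setImg {S : Str} {X U : Set (Set S.M)} (R : RUP S X U) (A : Set S.M) :
    Set R.K.M := {b | R.memK b A}

/-- The second-order part of the expanded ultrapower `(ℱ/𝒰, 𝒳)`:
the (injected) copy of `X`. -/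
def RUP.X2 {S : Str} {X U : Set (Set S.M)} (R : RUP S X U) : Set (Set R.K.M) :=
  (fun A => R.setImg A) '' X

end PaperArith

namespace PaperArith

/-! ## Order facts from `PA⁻` -/

section Order

variable {S : Str}

theorem PAminus.lt_asymm (h : PAminus S) {a b : S.M} (h₁ : S.lt a b) : ¬ S.lt b a :=
  fun h₂ => h.lt_irrefl a (h.lt_trans _ _ _ h₁ h₂)

theorem PAminus.not_lt_zero (h : PAminus S) (a : S.M) : ¬ S.lt a S.zero := fun ha =>
  (h.zero_le a).elim (fun e => h.lt_irrefl S.zero (e ▸ ha)) fun h0 => h.lt_asymm h0 ha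

theorem PAminus.zero_add (h : PAminus S) (a : S.M) : S.add S.zero a = a := by
  rw [h.add_comm, h.add_zero]

theorem PAminus.lt_succ_self (h : PAminus S) (a : S.M) : S.lt a (S.add a S.one) := by
  have := h.add_lt_add _ _ a h.zero_lt_one
  rwa [h.zero_add, h.add_comm] at this

theorem PAminus.lt_succ_iff (h : PAminus S) {a b : S.M} :
    S.lt a (S.add b S.one) ↔ S.lt a b ∨ a = b := by
  constructor
  · intro hab
    rcases h.lt_total a b with h1 | h1 | h1
    · exact .inl h1
    · exact .inr h1
    · rcases h.discrete _ _ h1 with h2 | h2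
      · exact absurd (h2 ▸ hab) (h.lt_irrefl _)
      · exact absurd hab (h.lt_asymm h2)
  · rintro (h1 | rfl)
    · exact h.lt_trans _ _ _ h1 (h.lt_succ_self b)
    · exact h.lt_succ_self a

theorem PAminus.not_lt_iff (h : PAminus S) {a b : S.M} :
    ¬ S.lt a b ↔ S.lt b (S.add a S.one) := by
  rw [h.lt_succ_iff]
  constructor
  · intro hn
    rcases h.lt_total a b with h1 | h1 | h1
    · exact absurd h1 hn
    · exact .inr h1.symm
    · exact .inl h1
  · rintro (h1 | rfl)
    · exact h.lt_asymm h1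
    · exact h.lt_irrefl b

theorem PAminus.exists_gt_both (h : PAminus S) (a b : S.M) : ∃ c, S.lt a c ∧ S.lt b c := by
  by_cases hab : S.lt a b
  · exact ⟨_, h.lt_trans _ _ _ hab (h.lt_succ_self b), h.lt_succ_self b⟩
  · exact ⟨_, h.lt_succ_self a, h.not_lt_iff.1 hab⟩

theorem PAminus.eq_zero_of_add_eq (h : PAminus S) {a u : S.M} (hu : S.add u a = a) :
    u = S.zero := by
  refine (h.zero_le u).resolve_right fun h0 => h.lt_irrefl a ?_
  have := h.add_lt_add _ _ a h0
  rwa [hu, h.zero_add] at this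

/-- Downward induction: if induction up to `a` holds for the reversed complement
`z ↦ a < z ∨ ∃ u, u + z = a ∧ ¬ P u`, then it holds for `P`. -/
theorem PAminus.reverse_induction (h : PAminus S) (P : S.M → Prop) (a : S.M)
    (hind : (S.lt a S.zero ∨ ∃ u, S.add u S.zero = a ∧ ¬ P u) →
      (∀ z, (S.lt a z ∨ ∃ u, S.add u z = a ∧ ¬ P u) →
        (S.lt a (S.add z S.one) ∨ ∃ u, S.add u (S.add z S.one) = a ∧ ¬ P u)) →
      (S.lt a a ∨ ∃ u, S.add u a = a ∧ ¬ P u))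
    (h0 : P S.zero) (hs : ∀ u, S.lt u a → P u → P (S.add u S.one)) : P a := by
  by_contra hPa
  have hstep : ∀ z, (S.lt a z ∨ ∃ u, S.add u z = a ∧ ¬ P u) →
      (S.lt a (S.add z S.one) ∨ ∃ u, S.add u (S.add z S.one) = a ∧ ¬ P u) := by
    rintro z (h1 | ⟨u, hu, hP⟩)
    · exact .inl (h.lt_trans _ _ _ h1 (h.lt_succ_self z))
    · rcases h.zero_le u with rfl | hpos
      · exact absurd h0 hP
      · obtain ⟨u', rfl⟩ := h.pred u hpos
        refine .inr ⟨u', by rw [← hu, h.add_assoc, h.add_comm S.one], fun hP' => hP (hs u' ?_ hP')⟩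
        rw [← hu]
        rcases h.zero_le z with rfl | hz
        · rw [h.add_zero]; exact h.lt_succ_self u'
        · have := h.add_lt_add _ _ (S.add u' S.one) hz
          rw [h.zero_add, h.add_comm z] at this
          exact h.lt_trans _ _ _ (h.lt_succ_self u') this
  rcases hind (.inr ⟨a, h.add_zero a, hPa⟩) hstep with h1 | ⟨u, hu, hP⟩
  · exact h.lt_irrefl a h1
  · rw [h.eq_zero_of_add_eq hu] at hP
    exact hP h0

end Order

/-! ## A semantic form of the arithmetic hierarchy

Predicates are considered uniformly over a family of structures, each equipped with a
sequence of parameters.  Variables are handled in the style of de Bruijn. -/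

/-- Prepend `m` to the valuation `v`. -/
def vcons {α : Type} (m : α) (v : ℕ → α) : ℕ → α
  | 0 => m
  | k + 1 => v k

@[simp] theorem vcons_zero {α : Type} (m : α) (v : ℕ → α) : vcons m v 0 = m := rfl

@[simp] theorem vcons_succ {α : Type} (m : α) (v : ℕ → α) (k : ℕ) :
    vcons m v (k + 1) = v k := rfl

theorem vcons_eta {α : Type} (v : ℕ → α) : vcons (v 0) (fun k => v (k + 1)) = v := by
  funext k; cases k <;> rfl

theorem comp_vcons {α β : Type} (f : α → β) (m : α) (v : ℕ → α) :
    (fun k => f (vcons m v k)) = vcons (f m) (fun k => f (v k)) := by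
  funext k; cases k <;> rfl

/-- A family of structures with distinguished sequences of parameters. -/
structure Fam : Type 1 where
  I : Type
  str : I → Str
  par : (i : I) → ℕ → (str i).M

/-- Functions of a valuation, uniformly over a family. -/
abbrev Fam.Fn (F : Fam) := (i : F.I) → (ℕ → (F.str i).M) → (F.str i).M

/-- Predicates of a valuation, uniformly over a family. -/
abbrev Fam.Pred (F : Fam) := (i : F.I) → (ℕ → (F.str i).M) → Prop

/-- Functions given by terms with parameters. -/
inductive TermFn (F : Fam) : F.Fn → Prop
  | var (k : ℕ) : TermFn F fun _ v => v k
  | par (c : ℕ) : TermFn F fun i _ => F.par i c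
  | zero : TermFn F fun i _ => (F.str i).zero
  | one : TermFn F fun i _ => (F.str i).one
  | add {t u : F.Fn} : TermFn F t → TermFn F u →
      TermFn F fun i v => (F.str i).add (t i v) (u i v)
  | mul {t u : F.Fn} : TermFn F t → TermFn F u →
      TermFn F fun i v => (F.str i).mul (t i v) (u i v)

/-- Predicates given by bounded formulas with parameters. -/
inductive BddPred (F : Fam) : F.Pred → Prop
  | eq {t u : F.Fn} : TermFn F t → TermFn F u → BddPred F fun i v => t i v = u i v
  | lt {t u : F.Fn} : TermFn F t → TermFn F u → BddPred F fun i v => (F.str i).lt (t i v) (u i v)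
  | not {P : F.Pred} : BddPred F P → BddPred F fun i v => ¬ P i v
  | and {P Q : F.Pred} : BddPred F P → BddPred F Q → BddPred F fun i v => P i v ∧ Q i v
  | ball' {t : F.Fn} {P : F.Pred} : TermFn F t → BddPred F P →
      BddPred F fun i v => ∀ m, (F.str i).lt m (t i v) → P i (vcons m v)

/-- The existential (`true`) or universal (`false`) quantifier. -/
def Quant {α : Type} : Bool → (α → Prop) → Prop
  | true, P => ∃ m, P m
  | false, P => ∀ m, P m

/-- Closure of a class of predicates under one kind of quantifier. -/
inductive Block {F : Fam} (b : Bool) (C : F.Pred → Prop) : F.Pred → Prop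
  | base {P : F.Pred} : C P → Block b C P
  | quant {P : F.Pred} : Block b C P → Block b C fun i v => Quant b fun m => P i (vcons m v)

/-- The classes `Σₖ` (`b = true`) and `Πₖ` (`b = false`) of predicates. -/
def Hier (F : Fam) (b : Bool) : ℕ → F.Pred → Prop
  | 0 => BddPred F
  | k + 1 => Block b (Hier F (!b) k)

section Closure

variable {F : Fam} {b : Bool} {k l : ℕ} {P Q : F.Pred}

/-- Substitutions all of whose components are term functions. -/
def SubstFn (F : Fam) (s : (i : F.I) → (ℕ → (F.str i).M) → ℕ → (F.str i).M) : Prop :=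
  ∀ j, TermFn F fun i v => s i v j

theorem TermFn.subst {t : F.Fn} (ht : TermFn F t)
    {s : (i : F.I) → (ℕ → (F.str i).M) → ℕ → (F.str i).M} (hs : SubstFn F s) :
    TermFn F fun i v => t i (s i v) := by
  induction ht with
  | var j => exact hs j
  | par c => exact .par c
  | zero => exact .zero
  | one => exact .one
  | add _ _ h₁ h₂ => exact .add h₁ h₂
  | mul _ _ h₁ h₂ => exact .mul h₁ h₂

theorem SubstFn.shift (d : ℕ) : SubstFn F fun _ v j => v (j + d) := fun j => .var (j + d)

theorem SubstFn.vcons {t : F.Fn} (ht : TermFn F t)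
    {s : (i : F.I) → (ℕ → (F.str i).M) → ℕ → (F.str i).M} (hs : SubstFn F s) :
    SubstFn F fun i v => vcons (t i v) (s i v)
  | 0 => ht
  | j + 1 => hs j

theorem SubstFn.lift {s : (i : F.I) → (ℕ → (F.str i).M) → ℕ → (F.str i).M}
    (hs : SubstFn F s) :
    SubstFn F fun i w => PaperArith.vcons (w 0) (s i fun j => w (j + 1)) :=
  .vcons (.var 0) fun j => (hs j).subst (.shift 1)

theorem SubstFn.upd (x : ℕ) {t : F.Fn} (ht : TermFn F t)
    {s : (i : F.I) → (ℕ → (F.str i).M) → ℕ → (F.str i).M} (hs : SubstFn F s) :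
    SubstFn F fun i v => PaperArith.upd (s i v) x (t i v) := by
  intro j
  by_cases h : j = x
  · simpa only [PaperArith.upd, h, if_true] using ht
  · simpa only [PaperArith.upd, h, if_false] using hs j

theorem BddPred.subst (hP : BddPred F P)
    {s : (i : F.I) → (ℕ → (F.str i).M) → ℕ → (F.str i).M} (hs : SubstFn F s) :
    BddPred F fun i v => P i (s i v) := by
  induction hP generalizing s with
  | eq ht hu => exact .eq (ht.subst hs) (hu.subst hs)
  | lt ht hu => exact .lt (ht.subst hs) (hu.subst hs)
  | not _ ih => exact .not (ih hs)
  | and _ _ ih₁ ih₂ => exact .and (ih₁ hs) (ih₂ hs)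
  | ball' ht _ ih => exact .ball' (ht.subst hs) (ih hs.lift)

theorem BddPred.of_iff (hP : BddPred F P) (h : ∀ i v, Q i v ↔ P i v) : BddPred F Q := by
  rwa [show Q = P from funext fun i => funext fun v => propext (h i v)]

theorem BddPred.or (hP : BddPred F P) (hQ : BddPred F Q) : BddPred F fun i v => P i v ∨ Q i v :=
  (hP.not.and hQ.not).not.of_iff fun i v => by tauto

theorem BddPred.imp (hP : BddPred F P) (hQ : BddPred F Q) :
    BddPred F fun i v => (P i v → Q i v) :=
  (hP.and hQ.not).not.of_iff fun i v => by tauto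

theorem BddPred.ball {t : F.Fn} {R : (i : F.I) → (F.str i).M → (ℕ → (F.str i).M) → Prop}
    (ht : TermFn F t) (hR : BddPred F fun i w => R i (w 0) fun j => w (j + 1)) :
    BddPred F fun i v => ∀ m, (F.str i).lt m (t i v) → R i m v :=
  .ball' ht hR

theorem BddPred.bex {t : F.Fn} {R : (i : F.I) → (F.str i).M → (ℕ → (F.str i).M) → Prop}
    (ht : TermFn F t) (hR : BddPred F fun i w => R i (w 0) fun j => w (j + 1)) :
    BddPred F fun i v => ∃ m, (F.str i).lt m (t i v) ∧ R i m v :=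
  (BddPred.ball (R := fun i m v => ¬ R i m v) ht hR.not).not.of_iff fun i v => by
    push Not; rfl

theorem Hier.of_iff (hP : Hier F b k P) (h : ∀ i v, Q i v ↔ P i v) : Hier F b k Q := by
  rwa [show Q = P from funext fun i => funext fun v => propext (h i v)]

theorem Hier.subst (hP : Hier F b k P)
    {s : (i : F.I) → (ℕ → (F.str i).M) → ℕ → (F.str i).M} (hs : SubstFn F s) :
    Hier F b k fun i v => P i (s i v) := by
  induction k generalizing b P s with
  | zero => exact BddPred.subst hP hs
  | succ k ih =>
    induction hP generalizing s with
    | base h => exact .base (ih h hs)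
    | quant _ ih' => exact .quant (ih' hs.lift)

theorem Hier.shift (hP : Hier F b k P) : Hier F b k fun i v => P i fun j => v (j + 1) :=
  hP.subst (.shift 1)

theorem Hier.of_bdd (hP : BddPred F P) : Hier F b k P := by
  induction k generalizing b with
  | zero => exact hP
  | succ k ih => exact .base ih

theorem Hier.swap (hP : Hier F (!b) k P) : Hier F b (k + 1) P := Block.base hP

theorem Hier.succ (hP : Hier F b k P) : Hier F b (k + 1) P := by
  induction k generalizing b P with
  | zero => exact .base hP
  | succ k ih =>
    induction hP with
    | base h => exact .base (ih h)
    | quant _ ih' => exact .quant ih'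

theorem Hier.mono (hP : Hier F b k P) (hkl : k ≤ l) : Hier F b l P := by
  induction hkl with
  | refl => exact hP
  | step _ ih => exact ih.succ

theorem Hier.cross {b' : Bool} (hP : Hier F b k P) (hkl : k < l) : Hier F b' l P := by
  refine Hier.mono (k := k + 1) ?_ hkl
  by_cases h : b' = b
  · subst h; exact hP.succ
  · refine Hier.swap ?_
    rwa [show (!b') = b by cases b <;> cases b' <;> simp_all]

theorem Hier.ex {R : (i : F.I) → (F.str i).M → (ℕ → (F.str i).M) → Prop}
    (hR : Hier F true (k + 1) fun i w => R i (w 0) fun j => w (j + 1)) :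
    Hier F true (k + 1) fun i v => ∃ m, R i m v :=
  Block.quant hR

theorem Hier.all {R : (i : F.I) → (F.str i).M → (ℕ → (F.str i).M) → Prop}
    (hR : Hier F false (k + 1) fun i w => R i (w 0) fun j => w (j + 1)) :
    Hier F false (k + 1) fun i v => ∀ m, R i m v :=
  Block.quant hR

theorem not_quant {α : Type} (b : Bool) (P : α → Prop) :
    ¬ Quant b P ↔ Quant (!b) fun m => ¬ P m := by
  cases b <;> simp [Quant]

theorem Hier.not (hP : Hier F b k P) : Hier F (!b) k fun i v => ¬ P i v := by
  induction k generalizing b P with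
  | zero => exact BddPred.not hP
  | succ k ih =>
    induction hP with
    | base h => exact .base (ih h)
    | quant _ ih' => exact Hier.of_iff (Block.quant ih') fun i v => not_quant _ _

theorem Hier.and_or (hP : Hier F b k P) (hQ : Hier F b k Q) :
    Hier F b k (fun i v => P i v ∧ Q i v) ∧ Hier F b k (fun i v => P i v ∨ Q i v) := by
  induction k generalizing b P Q with
  | zero => exact ⟨BddPred.and hP hQ, BddPred.or hP hQ⟩
  | succ k ih =>
    have inner : ∀ {P Q : F.Pred}, Hier F (!b) k P → Block b (Hier F (!b) k) Q →
        Hier F b (k + 1) (fun i v => P i v ∧ Q i v) ∧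
        Hier F b (k + 1) (fun i v => P i v ∨ Q i v) := by
      intro P Q hP hQ
      induction hQ generalizing P with
      | base h => exact ⟨.base (ih hP h).1, .base (ih hP h).2⟩
      | quant _ ih' =>
        refine ⟨Hier.of_iff (Block.quant (ih' hP.shift).1) fun i v => ?_,
          Hier.of_iff (Block.quant (ih' hP.shift).2) fun i v => ?_⟩ <;>
        · have : Nonempty (F.str i).M := ⟨(F.str i).zero⟩
          cases b <;> simp [Quant, exists_or, forall_and, forall_or_left]
    change Block b (Hier F (!b) k) P at hP
    induction hP generalizing Q with
    | base h => exact inner h hQ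
    | quant _ ih' =>
      refine ⟨Hier.of_iff (Block.quant (ih' hQ.shift).1) fun i v => ?_,
          Hier.of_iff (Block.quant (ih' hQ.shift).2) fun i v => ?_⟩ <;>
        · have : Nonempty (F.str i).M := ⟨(F.str i).zero⟩
          cases b <;> simp [Quant, exists_or, forall_and, forall_or_right]

theorem Hier.and (hP : Hier F b k P) (hQ : Hier F b k Q) :
    Hier F b k fun i v => P i v ∧ Q i v := (hP.and_or hQ).1

theorem Hier.or (hP : Hier F b k P) (hQ : Hier F b k Q) :
    Hier F b k fun i v => P i v ∨ Q i v := (hP.and_or hQ).2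

theorem Hier.imp (hP : Hier F (!b) k P) (hQ : Hier F b k Q) :
    Hier F b k fun i v => (P i v → Q i v) := by
  have h := hP.not
  rw [Bool.not_not] at h
  exact (h.or hQ).of_iff fun i v => by tauto

theorem TermFn.support {t : F.Fn} (ht : TermFn F t) :
    ∃ N, ∀ i v v', (∀ j < N, v j = v' j) → t i v = t i v' := by
  induction ht with
  | var j => exact ⟨j + 1, fun i v v' h => h j (Nat.lt_succ_self j)⟩
  | par c => exact ⟨0, fun _ _ _ _ => rfl⟩
  | zero => exact ⟨0, fun _ _ _ _ => rfl⟩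
  | one => exact ⟨0, fun _ _ _ _ => rfl⟩
  | add _ _ h₁ h₂ | mul _ _ h₁ h₂ =>
    obtain ⟨N₁, h₁⟩ := h₁
    obtain ⟨N₂, h₂⟩ := h₂
    refine ⟨max N₁ N₂, fun i v v' h => ?_⟩
    dsimp only
    rw [h₁ i v v' fun j hj => h j (lt_max_of_lt_left hj),
      h₂ i v v' fun j hj => h j (lt_max_of_lt_right hj)]

theorem vcons_agree {α : Type} {N : ℕ} {v v' : ℕ → α} (h : ∀ j < N, v j = v' j) (m : α) :
    ∀ j < N, vcons m v j = vcons m v' j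
  | 0, _ => rfl
  | j + 1, hj => h j (Nat.lt_of_succ_lt hj)

theorem BddPred.support (hP : BddPred F P) :
    ∃ N, ∀ i v v', (∀ j < N, v j = v' j) → (P i v ↔ P i v') := by
  induction hP with
  | eq h₁ h₂ | lt h₁ h₂ =>
    obtain ⟨N₁, h₁⟩ := h₁.support
    obtain ⟨N₂, h₂⟩ := h₂.support
    refine ⟨max N₁ N₂, fun i v v' h => ?_⟩
    dsimp only
    rw [h₁ i v v' fun j hj => h j (lt_max_of_lt_left hj),
      h₂ i v v' fun j hj => h j (lt_max_of_lt_right hj)]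
  | not _ ih =>
    obtain ⟨N, hN⟩ := ih
    exact ⟨N, fun i v v' h => not_congr (hN i v v' h)⟩
  | and _ _ h₁ h₂ =>
    obtain ⟨N₁, h₁⟩ := h₁
    obtain ⟨N₂, h₂⟩ := h₂
    exact ⟨max N₁ N₂, fun i v v' h => and_congr
      (h₁ i v v' fun j hj => h j (lt_max_of_lt_left hj))
      (h₂ i v v' fun j hj => h j (lt_max_of_lt_right hj))⟩
  | ball' h₁ _ h₂ =>
    obtain ⟨N₁, h₁⟩ := h₁.support
    obtain ⟨N₂, h₂⟩ := h₂
    refine ⟨max N₁ N₂, fun i v v' h => forall_congr' fun m => ?_⟩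
    rw [h₁ i v v' fun j hj => h j (lt_max_of_lt_left hj),
      h₂ i _ _ (vcons_agree (fun j hj => h j (lt_max_of_lt_right hj)) m)]

theorem Hier.support (hP : Hier F b k P) :
    ∃ N, ∀ i v v', (∀ j < N, v j = v' j) → (P i v ↔ P i v') := by
  induction k generalizing b P with
  | zero => exact BddPred.support hP
  | succ k ih =>
    induction hP with
    | base h => exact ih h
    | quant _ ih' =>
      obtain ⟨N, hN⟩ := ih'
      refine ⟨N, fun i v v' h => iff_of_eq (congrArg (Quant _) (funext fun m => ?_))⟩
      exact propext (hN i _ _ (vcons_agree h m))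

end Closure

section Syntactic

variable {F : Fam} {b : Bool} {k : ℕ} {P : F.Pred}

theorem TermFn.of_tval (t : Term) : TermFn F fun i v => tval (F.str i) v t := by
  induction t with
  | var j => exact .var j
  | zero => exact .zero
  | one => exact .one
  | add _ _ h₁ h₂ => exact .add h₁ h₂
  | mul _ _ h₁ h₂ => exact .mul h₁ h₂

theorem SubstFn.updVar (x : ℕ) :
    SubstFn F fun _ w => PaperArith.upd (fun j => w (j + 1)) x (w 0) :=
  .upd x (.var 0) (.shift 1)

theorem BddPred.of_delta0 {φ : Fml} (hφ : Delta0 φ) :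
    BddPred F fun i v => Sat0 (F.str i) v φ := by
  induction hφ with
  | eq t u => exact .eq (.of_tval t) (.of_tval u)
  | lt t u => exact .lt (.of_tval t) (.of_tval u)
  | not _ h => exact .not h
  | and _ _ h₁ h₂ => exact .and h₁ h₂
  | or _ _ h₁ h₂ => exact .or h₁ h₂
  | imp _ _ h₁ h₂ => exact .imp h₁ h₂
  | @ball x t φ _ h =>
    exact .ball (R := fun i m v => Sat0 (F.str i) (PaperArith.upd v x m) φ) (.of_tval t)
      (h.subst (.updVar x))
  | @bex x t φ _ h =>
    exact .bex (R := fun i m v => Sat0 (F.str i) (PaperArith.upd v x m) φ) (.of_tval t)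
      (h.subst (.updVar x))

mutual
theorem Hier.of_isSigma : ∀ {k : ℕ} {φ : Fml}, IsSigma k φ →
    Hier F true k fun i v => Sat0 (F.str i) v φ
  | _, _, .delta0 h => .of_bdd (.of_delta0 h)
  | _, _, .ofPi h => .swap (Hier.of_isPi h)
  | _, _, .ex x (φ := φ) h =>
    .ex (R := fun i m v => Sat0 (F.str i) (PaperArith.upd v x m) φ)
      ((Hier.of_isSigma h).subst (.updVar x))
theorem Hier.of_isPi : ∀ {k : ℕ} {φ : Fml}, IsPi k φ →
    Hier F false k fun i v => Sat0 (F.str i) v φ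
  | _, _, .delta0 h => .of_bdd (.of_delta0 h)
  | _, _, .ofSigma h => .swap (Hier.of_isSigma h)
  | _, _, .all x (φ := φ) h =>
    .all (R := fun i m v => Sat0 (F.str i) (PaperArith.upd v x m) φ)
      ((Hier.of_isPi h).subst (.updVar x))
end

/-- Variable names for use below `d` quantifiers: bound variables are named by the multiples of
three below `3 * d`, parameters by the numbers congruent to two. -/
def GoodNames (d : ℕ) (ν : ℕ → ℕ) : Prop :=
  (∀ j e, d ≤ e → ν j ≠ 3 * e) ∧ ∀ j c, ν j ≠ 3 * c + 2

theorem GoodNames.vcons {d : ℕ} {ν : ℕ → ℕ} (h : GoodNames d ν) :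
    GoodNames (d + 1) (vcons (3 * d) ν) := by
  constructor
  · rintro (_ | j) e he
    · simp only [vcons_zero]; omega
    · exact h.1 j e (by omega)
  · rintro (_ | j) c
    · simp only [vcons_zero]; omega
    · exact h.2 j c

theorem GoodNames.upd_vcons {d : ℕ} {ν : ℕ → ℕ} (h : GoodNames d ν) {α : Type}
    (w : ℕ → α) (m : α) :
    (fun j => upd w (3 * d) m (PaperArith.vcons (3 * d) ν j)) =
      PaperArith.vcons m fun j => w (ν j) := by
  funext j
  cases j with
  | zero => simp [upd]
  | succ j => simp [upd, h.1 j d le_rfl]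

theorem TermFn.exists_term {t : F.Fn} (ht : TermFn F t) (ν : ℕ → ℕ) :
    ∃ τ : Term, ∀ i w, (∀ c, w (3 * c + 2) = F.par i c) →
      tval (F.str i) w τ = t i fun j => w (ν j) := by
  induction ht with
  | var j => exact ⟨.var (ν j), fun _ _ _ => rfl⟩
  | par c => exact ⟨.var (3 * c + 2), fun _ _ h => h c⟩
  | zero => exact ⟨.zero, fun _ _ _ => rfl⟩
  | one => exact ⟨.one, fun _ _ _ => rfl⟩
  | add _ _ h₁ h₂ =>
    obtain ⟨τ₁, h₁⟩ := h₁
    obtain ⟨τ₂, h₂⟩ := h₂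
    exact ⟨.add τ₁ τ₂, fun i w h => congrArg₂ _ (h₁ i w h) (h₂ i w h)⟩
  | mul _ _ h₁ h₂ =>
    obtain ⟨τ₁, h₁⟩ := h₁
    obtain ⟨τ₂, h₂⟩ := h₂
    exact ⟨.mul τ₁ τ₂, fun i w h => congrArg₂ _ (h₁ i w h) (h₂ i w h)⟩

theorem upd_par {i : F.I} {w : ℕ → (F.str i).M} (h : ∀ c, w (3 * c + 2) = F.par i c) (d : ℕ)
    (m : (F.str i).M) : ∀ c, upd w (3 * d) m (3 * c + 2) = F.par i c := fun c => by
  rw [upd, if_neg (by omega), h c]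

theorem BddPred.exists_delta0 (hP : BddPred F P) {d : ℕ} {ν : ℕ → ℕ} (hν : GoodNames d ν) :
    ∃ φ, Delta0 φ ∧ ∀ i w, (∀ c, w (3 * c + 2) = F.par i c) →
      (Sat0 (F.str i) w φ ↔ P i fun j => w (ν j)) := by
  induction hP generalizing d ν with
  | eq h₁ h₂ =>
    obtain ⟨τ₁, h₁⟩ := h₁.exists_term ν
    obtain ⟨τ₂, h₂⟩ := h₂.exists_term ν
    refine ⟨.eq τ₁ τ₂, .eq _ _, fun i w h => ?_⟩
    dsimp only
    rw [← h₁ i w h, ← h₂ i w h]; rfl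
  | lt h₁ h₂ =>
    obtain ⟨τ₁, h₁⟩ := h₁.exists_term ν
    obtain ⟨τ₂, h₂⟩ := h₂.exists_term ν
    refine ⟨.lt τ₁ τ₂, .lt _ _, fun i w h => ?_⟩
    dsimp only
    rw [← h₁ i w h, ← h₂ i w h]; rfl
  | not _ ih =>
    obtain ⟨φ, hφ, h⟩ := ih hν
    exact ⟨.not φ, .not hφ, fun i w hw => not_congr (h i w hw)⟩
  | and _ _ h₁ h₂ =>
    obtain ⟨φ₁, hφ₁, h₁⟩ := h₁ hν
    obtain ⟨φ₂, hφ₂, h₂⟩ := h₂ hν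
    exact ⟨.and φ₁ φ₂, .and hφ₁ hφ₂, fun i w hw => and_congr (h₁ i w hw) (h₂ i w hw)⟩
  | ball' h₁ _ h₂ =>
    obtain ⟨τ, h₁⟩ := h₁.exists_term ν
    obtain ⟨φ, hφ, h₂⟩ := h₂ hν.vcons
    refine ⟨.ball (3 * d) τ φ, .ball _ _ hφ, fun i w hw => forall_congr' fun m => ?_⟩
    rw [← h₁ i w hw, ← hν.upd_vcons]
    exact imp_congr_right fun _ => h₂ i _ (upd_par hw d m)

/-- `Σₖ` formulas for `b = true`, `Πₖ` formulas for `b = false`. -/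
def IsHier : Bool → ℕ → Fml → Prop
  | true => IsSigma
  | false => IsPi

theorem Hier.exists_fml' (hP : Hier F b k P) {d : ℕ} {ν : ℕ → ℕ} (hν : GoodNames d ν) :
    ∃ φ, IsHier b k φ ∧ ∀ i w, (∀ c, w (3 * c + 2) = F.par i c) →
      (Sat0 (F.str i) w φ ↔ P i fun j => w (ν j)) := by
  induction k generalizing b P d ν with
  | zero =>
    obtain ⟨φ, hφ, h⟩ := BddPred.exists_delta0 hP hν
    refine ⟨φ, ?_, h⟩
    cases b
    · exact .delta0 hφ
    · exact .delta0 hφ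
  | succ k ih =>
    induction hP generalizing d ν with
    | base h =>
      obtain ⟨φ, hφ, h⟩ := ih h hν
      refine ⟨φ, ?_, h⟩
      cases b
      · exact .ofSigma hφ
      · exact .ofPi hφ
    | quant _ ih' =>
      obtain ⟨φ, hφ, h⟩ := ih' hν.vcons
      have key := fun (i : F.I) (w : ℕ → (F.str i).M) (hw : ∀ c, w (3 * c + 2) = F.par i c)
        (m : (F.str i).M) => h i _ (upd_par hw d m)
      simp only [hν.upd_vcons] at key
      cases b
      · exact ⟨.all (3 * d) φ, .all _ hφ, fun i w hw => forall_congr' (key i w hw)⟩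
      · exact ⟨.ex (3 * d) φ, .ex _ hφ, fun i w hw => exists_congr (key i w hw)⟩

theorem Hier.exists_fml (hP : Hier F b k P) :
    ∃ φ, IsHier b k φ ∧ ∀ i w, (∀ c, w (3 * c + 2) = F.par i c) →
      (Sat0 (F.str i) w φ ↔ P i fun j => w (3 * j + 1)) :=
  hP.exists_fml' (d := 0) (ν := fun j => 3 * j + 1)
    ⟨fun _ _ _ => by dsimp only; omega, fun _ _ => by dsimp only; omega⟩

/-- A valuation interpreting the variables `3 * j + 1` by `v` and the variables `3 * c + 2`
by `q`. -/
def mergeVal {α : Type} (v q : ℕ → α) (x : ℕ) : α :=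
  if x % 3 = 2 then q (x / 3) else v (x / 3)

theorem mergeVal_par {α : Type} (v q : ℕ → α) (c : ℕ) : mergeVal v q (3 * c + 2) = q c := by
  rw [mergeVal, if_pos (by omega)]; congr 1; omega

theorem mergeVal_var {α : Type} (v q : ℕ → α) (j : ℕ) : mergeVal v q (3 * j + 1) = v j := by
  rw [mergeVal, if_neg (by omega)]; congr 1; omega

theorem mergeVal_upd_par {α : Type} (v q : ℕ → α) (m : α) (c : ℕ) :
    upd (mergeVal v q) 1 m (3 * c + 2) = q c := by
  rw [upd, if_neg (by omega), mergeVal_par]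

theorem mergeVal_upd_var {α : Type} (v q : ℕ → α) (m m' : α) :
    (fun j => upd (mergeVal (vcons m v) q) 1 m' (3 * j + 1)) = vcons m' v := by
  funext j
  cases j with
  | zero => simp [upd]
  | succ j => rw [upd, if_neg (by omega), mergeVal_var]; rfl

/-- The family obtained by reindexing along `g`. -/
abbrev Fam.reindex (F : Fam) {J : Type} (g : J → F.I) : Fam :=
  ⟨J, fun j => F.str (g j), fun j => F.par (g j)⟩

theorem TermFn.extend {J : Type} (g : J → F.I) {t : (F.reindex g).Fn} (ht : TermFn _ t) :
    ∃ u : F.Fn, TermFn F u ∧ ∀ j v, u (g j) v = t j v := by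
  induction ht with
  | var k => exact ⟨_, .var k, fun _ _ => rfl⟩
  | par c => exact ⟨_, .par c, fun _ _ => rfl⟩
  | zero => exact ⟨_, .zero, fun _ _ => rfl⟩
  | one => exact ⟨_, .one, fun _ _ => rfl⟩
  | add _ _ h₁ h₂ =>
    obtain ⟨u₁, hu₁, h₁⟩ := h₁
    obtain ⟨u₂, hu₂, h₂⟩ := h₂
    exact ⟨_, .add hu₁ hu₂, fun j v => congrArg₂ _ (h₁ j v) (h₂ j v)⟩
  | mul _ _ h₁ h₂ =>
    obtain ⟨u₁, hu₁, h₁⟩ := h₁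
    obtain ⟨u₂, hu₂, h₂⟩ := h₂
    exact ⟨_, .mul hu₁ hu₂, fun j v => congrArg₂ _ (h₁ j v) (h₂ j v)⟩

theorem BddPred.extend {J : Type} (g : J → F.I) {P : (F.reindex g).Pred} (hP : BddPred _ P) :
    ∃ Q : F.Pred, BddPred F Q ∧ ∀ j v, Q (g j) v ↔ P j v := by
  induction hP with
  | eq h₁ h₂ =>
    obtain ⟨u₁, hu₁, h₁⟩ := h₁.extend g
    obtain ⟨u₂, hu₂, h₂⟩ := h₂.extend g
    exact ⟨_, .eq hu₁ hu₂, fun j v => by dsimp only; rw [h₁, h₂]⟩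
  | lt h₁ h₂ =>
    obtain ⟨u₁, hu₁, h₁⟩ := h₁.extend g
    obtain ⟨u₂, hu₂, h₂⟩ := h₂.extend g
    exact ⟨_, .lt hu₁ hu₂, fun j v => by dsimp only; rw [h₁, h₂]⟩
  | not _ ih =>
    obtain ⟨Q, hQ, h⟩ := ih
    exact ⟨_, .not hQ, fun j v => not_congr (h j v)⟩
  | and _ _ h₁ h₂ =>
    obtain ⟨Q₁, hQ₁, h₁⟩ := h₁
    obtain ⟨Q₂, hQ₂, h₂⟩ := h₂
    exact ⟨_, .and hQ₁ hQ₂, fun j v => and_congr (h₁ j v) (h₂ j v)⟩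
  | ball' h₁ _ h₂ =>
    obtain ⟨u, hu, h₁⟩ := h₁.extend g
    obtain ⟨Q, hQ, h₂⟩ := h₂
    exact ⟨_, .ball' hu hQ, fun j v => forall_congr' fun m => by rw [h₁, h₂]⟩

/-- Every predicate over a reindexed family extends to the original family. -/
theorem Hier.extend {J : Type} (g : J → F.I) {P : (F.reindex g).Pred} (hP : Hier _ b k P) :
    ∃ Q : F.Pred, Hier F b k Q ∧ ∀ j v, Q (g j) v ↔ P j v := by
  induction k generalizing b P with
  | zero => exact BddPred.extend g hP
  | succ k ih =>
    induction hP with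
    | base h =>
      obtain ⟨Q, hQ, h⟩ := ih h
      exact ⟨Q, .base hQ, h⟩
    | quant _ ih' =>
      obtain ⟨Q, hQ, h⟩ := ih'
      refine ⟨_, .quant hQ, fun j v => iff_of_eq (congrArg (Quant _) (funext fun m => ?_))⟩
      exact propext (h j _)

end Syntactic

section Collection

variable {F : Fam} {b : Bool} {k : ℕ} {P : F.Pred}

/-- Collection for `Πₖ` predicates in the member `i` of the family. -/
def CollAt (F : Fam) (i : F.I) (k : ℕ) : Prop :=
  ∀ P : F.Pred, Hier F false k P → ∀ v a,
    (∀ x, (F.str i).lt x a → ∃ y, P i (vcons y (vcons x v))) →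
    ∃ b, ∀ x, (F.str i).lt x a → ∃ y, (F.str i).lt y b ∧ P i (vcons y (vcons x v))

/-- The classes `Σₖ` and `Πₖ` are closed under bounded quantifiers. -/
structure BddClosed (F : Fam) (k : ℕ) : Prop where
  ball : ∀ {b : Bool} {t : F.Fn} {R : (i : F.I) → (F.str i).M → (ℕ → (F.str i).M) → Prop},
    TermFn F t → (Hier F b k fun i w => R i (w 0) fun j => w (j + 1)) →
    Hier F b k fun i v => ∀ m, (F.str i).lt m (t i v) → R i m v
  bex : ∀ {b : Bool} {t : F.Fn} {R : (i : F.I) → (F.str i).M → (ℕ → (F.str i).M) → Prop},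
    TermFn F t → (Hier F b k fun i w => R i (w 0) fun j => w (j + 1)) →
    Hier F b k fun i v => ∃ m, (F.str i).lt m (t i v) ∧ R i m v

theorem Hier.not_iff (hP : Hier F (!b) k fun i v => ¬ P i v) : Hier F b k P := by
  have := hP.not
  rw [Bool.not_not] at this
  exact this.of_iff fun i v => by simp

theorem BddClosed.exists_normal (hF : ∀ i, PAminus (F.str i)) (hk : BddClosed F k)
    (hP : Hier F true (k + 1) P) :
    ∃ R, Hier F false k R ∧ ∀ i v, P i v ↔ ∃ y, R i (vcons y v) := by
  change Block true (Hier F false k) P at hP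
  induction hP with
  | base h => exact ⟨_, h.shift, fun i v => ⟨fun hp => ⟨(F.str i).zero, hp⟩, fun ⟨_, hp⟩ => hp⟩⟩
  | quant _ ih =>
    obtain ⟨R, hR, h⟩ := ih
    refine ⟨fun i w => ∃ m, (F.str i).lt m (w 0) ∧ ∃ y, (F.str i).lt y (w 0) ∧
        R i (vcons y (vcons m fun j => w (j + 1))),
      hk.bex (R := fun i m w => ∃ y, (F.str i).lt y (w 0) ∧
        R i (vcons y (vcons m fun j => w (j + 1)))) (.var 0)
      (hk.bex (R := fun i y w => R i (vcons y (vcons (w 0) fun j => w (j + 2)))) (.var 1)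
        (hR.subst (.vcons (.var 0) (.vcons (.var 1) (.shift 3))))), fun i v => ?_⟩
    constructor
    · rintro ⟨m, hm⟩
      obtain ⟨y, hy⟩ := (h i _).1 hm
      obtain ⟨b, h₁, h₂⟩ := (hF i).exists_gt_both m y
      exact ⟨b, m, h₁, y, h₂, hy⟩
    · rintro ⟨b, m, _, y, _, hy⟩
      exact ⟨m, (h i _).2 ⟨y, hy⟩⟩

theorem BddClosed.exists_normal_pi (hF : ∀ i, PAminus (F.str i)) (hk : BddClosed F k)
    (hP : Hier F false (k + 1) P) :
    ∃ R, Hier F true k R ∧ ∀ i v, P i v ↔ ∀ y, R i (vcons y v) := by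
  obtain ⟨R, hR, h⟩ := hk.exists_normal hF hP.not
  exact ⟨_, hR.not, fun i v => by rw [← not_iff_not, h]; push Not; rfl⟩

theorem BddClosed.of_coll (hF : ∀ i, PAminus (F.str i)) (hC : ∀ j < k, ∀ i, CollAt F i j) :
    BddClosed F k := by
  induction k with
  | zero => exact ⟨fun ht hR => BddPred.ball ht hR, fun ht hR => BddPred.bex ht hR⟩
  | succ k ih =>
    have hk := ih fun j hj => hC j (Nat.lt_succ_of_lt hj)
    have hex : ∀ {t : F.Fn} {R : (i : F.I) → (F.str i).M → (ℕ → (F.str i).M) → Prop},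
        TermFn F t → (Hier F true (k + 1) fun i w => R i (w 0) fun j => w (j + 1)) →
        Hier F true (k + 1) fun i v => ∃ m, (F.str i).lt m (t i v) ∧ R i m v := by
      intro t R ht hR
      obtain ⟨Q, hQ, h⟩ := hk.exists_normal hF hR
      refine (Hier.ex (R := fun i y v => ∃ m, (F.str i).lt m (t i v) ∧ Q i (vcons y (vcons m v)))
        (.swap (hk.bex (R := fun i m w => Q i (vcons (w 0) (vcons m fun j => w (j + 1))))
          (ht.subst (.shift 1))
          (hQ.subst (.vcons (.var 1) (.vcons (.var 0) (.shift 2))))))).of_iff fun i v => ?_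
      have h' := fun m => h i (vcons m v)
      simp only [vcons_zero, vcons_succ] at h'
      constructor
      · rintro ⟨m, hm, hr⟩
        obtain ⟨y, hy⟩ := (h' m).1 hr
        exact ⟨y, m, hm, hy⟩
      · rintro ⟨y, m, hm, hy⟩
        exact ⟨m, hm, (h' m).2 ⟨y, hy⟩⟩
    have hall : ∀ {t : F.Fn} {R : (i : F.I) → (F.str i).M → (ℕ → (F.str i).M) → Prop},
        TermFn F t → (Hier F true (k + 1) fun i w => R i (w 0) fun j => w (j + 1)) →
        Hier F true (k + 1) fun i v => ∀ m, (F.str i).lt m (t i v) → R i m v := by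
      intro t R ht hR
      obtain ⟨Q, hQ, h⟩ := hk.exists_normal hF hR
      refine (Hier.ex (R := fun i b v => ∀ m, (F.str i).lt m (t i v) →
          ∃ y, (F.str i).lt y b ∧ Q i (vcons y (vcons m v)))
        (.swap (hk.ball (R := fun i m w => ∃ y, (F.str i).lt y (w 0) ∧
            Q i (vcons y (vcons m fun j => w (j + 1))))
          (ht.subst (.shift 1))
          (hk.bex (R := fun i y w => Q i (vcons y (vcons (w 0) fun j => w (j + 2)))) (.var 1)
          (hQ.subst (.vcons (.var 0) (.vcons (.var 1) (.shift 3)))))))).of_iff fun i v => ?_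
      have h' := fun m => h i (vcons m v)
      simp only [vcons_zero, vcons_succ] at h'
      constructor
      · intro hr
        exact hC k (Nat.lt_succ_self k) i Q hQ v (t i v) fun m hm => (h' m).1 (hr m hm)
      · rintro ⟨b, hb⟩ m hm
        obtain ⟨y, _, hy⟩ := hb m hm
        exact (h' m).2 ⟨y, hy⟩
    constructor
    · rintro (_ | _) t R ht hR
      · refine Hier.not_iff ((hex (R := fun i m v => ¬ R i m v) ht hR.not).of_iff fun i v => ?_)
        push Not; rfl
      · exact hall ht hR
    · rintro (_ | _) t R ht hR
      · refine Hier.not_iff ((hall (R := fun i m v => ¬ R i m v) ht hR.not).of_iff fun i v => ?_)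
        push Not; rfl
      · exact hex ht hR

end Collection

section Downward

variable {S K : Str} {e : Emb S K} {n k : ℕ} {b : Bool}

/-- The family consisting of the two structures of an extension. -/
abbrev pairFam (S K : Str) : Fam where
  I := Bool
  str := fun i => match i with
    | true => S
    | false => K
  par := fun i => match i with
    | true => fun _ => S.zero
    | false => fun _ => K.zero

theorem SigmaElem.transfer (he : SigmaElem e n) {P : (pairFam S K).Pred}
    (hP : Hier (pairFam S K) b n P) (v : ℕ → S.M) : P true v ↔ P false fun j => e.j (v j) := by
  have key : ∀ {P : (pairFam S K).Pred}, Hier (pairFam S K) true n P →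
      (P true v ↔ P false fun j => e.j (v j)) := by
    intro P hP
    obtain ⟨φ, hφ, h⟩ := hP.exists_fml
    have h₁ := h true (mergeVal v fun _ => S.zero) (mergeVal_par _ _)
    have h₂ := h false (fun x => e.j (mergeVal v (fun _ => S.zero) x)) fun c => by
      rw [mergeVal_par]; exact e.zero
    simp only [mergeVal_var] at h₁ h₂
    exact h₁.symm.trans ((he φ hφ _).trans h₂)
  cases b
  · exact not_iff_not.1 (key hP.not)
  · exact key hP

theorem SigmaElem.transfer_univ (he : SigmaElem e (n + 1)) {P : (pairFam S K).Pred}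
    (hP : Hier (pairFam S K) false (n + 1) P) (h : ∀ v, P true v) (v : ℕ → K.M) : P false v := by
  obtain ⟨N, hN⟩ := hP.support
  induction N generalizing P v with
  | zero =>
    exact (hN false _ _ (by simp)).1 ((he.transfer hP fun _ => S.zero).1 (h _))
  | succ N ih =>
    have := ih (P := fun i v => ∀ m, P i (vcons m v)) (Hier.all (R := fun i m v => P i (vcons m v))
      (hP.subst (.vcons (.var 0) (.shift 1)))) (fun v m => h _) (fun k => v (k + 1))
      (fun i v v' hv => forall_congr' fun m => hN i _ _ ?_) (v 0)
    · rwa [vcons_eta] at this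
    · rintro (_ | j) hj
      · rfl
      · exact hv j (Nat.lt_of_succ_lt_succ hj)

theorem SigmaElem.paMinus (he : SigmaElem e (n + 2)) (h : PAminus S) : PAminus K := by
  have key : ∀ {P : (pairFam S K).Pred}, Hier (pairFam S K) false 2 P → (∀ v, P true v) →
      ∀ v, P false v := fun hP => he.transfer_univ (hP.mono (by omega))
  let v₀ : ℕ → K.M := fun _ => K.zero
  have exSucc : Hier (pairFam S K) true 1
      fun i v => ∃ m, ((pairFam S K).str i).add m ((pairFam S K).str i).one = v 0 :=
    .ex (R := fun i m v => ((pairFam S K).str i).add m ((pairFam S K).str i).one = v 0)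
      (.of_bdd (.eq (.add (.var 0) .one) (.var 1)))
  have exSub : Hier (pairFam S K) true 1
      fun i v => ∃ m, ((pairFam S K).str i).add (v 0) m = v 1 :=
    .ex (R := fun i m v => ((pairFam S K).str i).add (v 0) m = v 1)
      (.of_bdd (.eq (.add (.var 1) (.var 0)) (.var 2)))
  constructor
  · exact fun a b c => key (.of_bdd (.eq (.add (.add (.var 0) (.var 1)) (.var 2))
      (.add (.var 0) (.add (.var 1) (.var 2))))) (fun _ => h.add_assoc _ _ _)
      (vcons a (vcons b (vcons c v₀)))
  · exact fun a b => key (.of_bdd (.eq (.add (.var 0) (.var 1)) (.add (.var 1) (.var 0))))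
      (fun _ => h.add_comm _ _) (vcons a (vcons b v₀))
  · exact fun a b c => key (.of_bdd (.eq (.mul (.mul (.var 0) (.var 1)) (.var 2))
      (.mul (.var 0) (.mul (.var 1) (.var 2))))) (fun _ => h.mul_assoc _ _ _)
      (vcons a (vcons b (vcons c v₀)))
  · exact fun a b => key (.of_bdd (.eq (.mul (.var 0) (.var 1)) (.mul (.var 1) (.var 0))))
      (fun _ => h.mul_comm _ _) (vcons a (vcons b v₀))
  · exact fun a b c => key (.of_bdd (.eq (.mul (.var 0) (.add (.var 1) (.var 2)))
      (.add (.mul (.var 0) (.var 1)) (.mul (.var 0) (.var 2))))) (fun _ => h.distrib _ _ _)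
      (vcons a (vcons b (vcons c v₀)))
  · exact fun a => key (.of_bdd (.eq (.add (.var 0) .zero) (.var 0)))
      (fun _ => h.add_zero _) (vcons a v₀)
  · exact fun a => key (.of_bdd (.eq (.mul (.var 0) .zero) .zero))
      (fun _ => h.mul_zero _) (vcons a v₀)
  · exact fun a => key (.of_bdd (.eq (.mul (.var 0) .one) (.var 0)))
      (fun _ => h.mul_one _) (vcons a v₀)
  · exact fun a => key (.of_bdd (.not (.lt (.var 0) (.var 0))))
      (fun _ => h.lt_irrefl _) (vcons a v₀)
  · exact fun a b c => key (.of_bdd (.imp (.lt (.var 0) (.var 1)) (.imp (.lt (.var 1) (.var 2))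
      (.lt (.var 0) (.var 2))))) (fun _ => h.lt_trans _ _ _) (vcons a (vcons b (vcons c v₀)))
  · exact fun a b => key (.of_bdd (.or (.lt (.var 0) (.var 1)) (.or (.eq (.var 0) (.var 1))
      (.lt (.var 1) (.var 0))))) (fun _ => h.lt_total _ _) (vcons a (vcons b v₀))
  · exact fun a b c => key (.of_bdd (.imp (.lt (.var 0) (.var 1))
      (.lt (.add (.var 0) (.var 2)) (.add (.var 1) (.var 2)))))
      (fun _ => h.add_lt_add _ _ _) (vcons a (vcons b (vcons c v₀)))
  · exact fun a b c => key (.of_bdd (.imp (.lt (.var 0) (.var 1)) (.imp (.lt .zero (.var 2))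
      (.lt (.mul (.var 0) (.var 2)) (.mul (.var 1) (.var 2))))))
      (fun _ => h.mul_lt_mul _ _ _) (vcons a (vcons b (vcons c v₀)))
  · exact key (.of_bdd (.lt .zero .one)) (fun _ => h.zero_lt_one) v₀
  · exact fun a => key (.of_bdd (.or (.eq (.var 0) .zero) (.lt .zero (.var 0))))
      (fun _ => h.zero_le _) (vcons a v₀)
  · exact fun a b => key (.of_bdd (.imp (.lt (.var 0) (.var 1))
      (.or (.eq (.add (.var 0) .one) (.var 1)) (.lt (.add (.var 0) .one) (.var 1)))))
      (fun _ => h.discrete _ _) (vcons a (vcons b v₀))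
  · exact fun a => key (.imp (.of_bdd (.lt .zero (.var 0))) (exSucc.cross (by omega)))
      (fun _ => h.pred _) (vcons a v₀)
  · exact fun a b => key (.imp (.of_bdd (.lt (.var 0) (.var 1))) (exSub.cross (by omega)))
      (fun _ => h.sub _ _) (vcons a (vcons b v₀))

theorem IsEndExt.exists_of_lt (hE : IsEndExt e) (hK : PAminus K) {a : S.M} {x : K.M}
    (h : K.lt x (e.j a)) : ∃ x', e.j x' = x ∧ S.lt x' a := by
  by_cases hx : x ∈ Set.range e.j
  · obtain ⟨x', rfl⟩ := hx
    exact ⟨x', rfl, (e.lt_iff _ _).2 h⟩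
  · exact absurd h (hK.lt_asymm (hE x hx a))

/-- The predicate `∃ b ∀ x < a ∃ y < b P`, as a predicate of `a` and the parameters of `P`. -/
def CollPred {F : Fam} (P : F.Pred) : F.Pred := fun i w =>
  ∃ b, ∀ x, (F.str i).lt x (w 0) → ∃ y, (F.str i).lt y b ∧
    P i (vcons y (vcons x fun j => w (j + 1)))

theorem Hier.collPred {F : Fam} {P : F.Pred} (hP : Hier F false k P) (hk : BddClosed F k) :
    Hier F true (k + 1) (CollPred P) :=
  .ex (R := fun i b w => ∀ x, (F.str i).lt x (w 0) → ∃ y, (F.str i).lt y b ∧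
      P i (vcons y (vcons x fun j => w (j + 1))))
    (.swap (hk.ball (R := fun i x w => ∃ y, (F.str i).lt y (w 0) ∧
        P i (vcons y (vcons x fun j => w (j + 2)))) (.var 1)
      (hk.bex (R := fun i y w => P i (vcons y (vcons (w 0) fun j => w (j + 3)))) (.var 1)
        (hP.subst (.vcons (.var 0) (.vcons (.var 1) (.shift 4)))))))

theorem SigmaElem.collAt (he : SigmaElem e (n + 2)) (h : PAminus S) (hp : IsProper e)
    (hE : IsEndExt e) (hk : k ≤ n) :
    CollAt (pairFam S K) true k ∧ (k < n → CollAt (pairFam S K) false k) := by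
  induction k using Nat.strong_induction_on with
  | _ k ih =>
  have hK := he.paMinus h
  have hF : ∀ i, PAminus ((pairFam S K).str i) := by
    rintro (_ | _)
    · exact hK
    · exact h
  have hcl : BddClosed (pairFam S K) k := by
    refine .of_coll hF fun j hj i => ?_
    cases i
    · exact (ih j hj (by omega)).2 (by omega)
    · exact (ih j hj (by omega)).1
  have hS : CollAt (pairFam S K) true k := by
    intro P hP v a hyp
    obtain ⟨c, hc⟩ := not_forall.1 hp
    refine (he.transfer ((hP.collPred hcl).mono (by omega)) (vcons a v)).2 ⟨c, fun x hx => ?_⟩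
    obtain ⟨x, rfl, hxa⟩ := hE.exists_of_lt hK hx
    obtain ⟨y, hy⟩ := hyp x hxa
    have := (he.transfer (hP.mono (by omega)) _).1 hy
    rw [comp_vcons, comp_vcons] at this
    exact ⟨e.j y, hE c hc y, this⟩
  refine ⟨hS, fun hkn P hP v a hyp => ?_⟩
  have hΘ : Hier (pairFam S K) false (n + 2) fun i w =>
      (∃ x, ((pairFam S K).str i).lt x (w 0) ∧ ∀ y, ¬ P i (vcons y (vcons x fun j => w (j + 1)))) ∨
        CollPred P i w := by
    refine Hier.cross (b := true) (k := k + 2) (.or ?_ ((hP.collPred hcl).mono (by omega)))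
      (by omega)
    exact .ex (R := fun i x w => ((pairFam S K).str i).lt x (w 0) ∧
        ∀ y, ¬ P i (vcons y (vcons x fun j => w (j + 1))))
      (.and (.of_bdd (.lt (.var 0) (.var 1))) (.swap (.all
        (R := fun i y w => ¬ P i (vcons y (vcons (w 0) fun j => w (j + 2))))
        ((hP.not.subst (.vcons (.var 0) (.vcons (.var 1) (.shift 3)))).cross (by omega)))))
  refine (he.transfer_univ hΘ (fun w => ?_) (vcons a v)).resolve_left ?_
  · by_cases hw : ∃ x, S.lt x (w 0) ∧ ∀ y, ¬ P true (vcons y (vcons x fun j => w (j + 1)))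
    · exact .inl hw
    · push Not at hw
      exact .inr (hS P hP _ _ hw)
  · rintro ⟨x, hx, hy⟩
    obtain ⟨y, hy'⟩ := hyp x hx
    exact hy y hy'

theorem MISigma.hier (hM : MISigma e n) {P : (pairFam S K).Pred}
    (hP : Hier (pairFam S K) true n P) (v : ℕ → K.M) (a : S.M) (h0 : P false (vcons K.zero v))
    (hs : ∀ m, K.lt m (e.j a) → P false (vcons m v) → P false (vcons (K.add m K.one) v)) :
    ∀ m, K.lt m (e.j a) → P false (vcons m v) := by
  obtain ⟨φ, hφ, h⟩ := hP.exists_fml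
  have key : ∀ m, Sat0 K (upd (mergeVal (vcons K.zero v) fun _ => K.zero) 1 m) φ ↔
      P false (vcons m v) := fun m => by
    rw [← mergeVal_upd_var v (fun _ => K.zero) K.zero m]
    exact h false _ (mergeVal_upd_par _ _ _)
  have := hM φ hφ (mergeVal (vcons K.zero v) fun _ => K.zero) 1 a
  simp only [key] at this
  exact this h0 hs

/-- Induction up to elements of the ground model for `Πₙ` predicates. -/
theorem MISigma.hier_pi (hM : MISigma e (n + 1)) (hK : PAminus K) {P : (pairFam S K).Pred}
    (hP : Hier (pairFam S K) false (n + 1) P) (v : ℕ → K.M) (a : S.M)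
    (h0 : P false (vcons K.zero v))
    (hs : ∀ m, K.lt m (e.j a) → P false (vcons m v) → P false (vcons (K.add m K.one) v)) :
    P false (vcons (e.j a) v) := by
  refine hK.reverse_induction (fun u => P false (vcons u v)) (e.j a) (fun h₁ h₂ => ?_) h0 hs
  have hQ : Hier (pairFam S K) true (n + 1) fun i w =>
      ((pairFam S K).str i).lt (w 1) (w 0) ∨ ∃ u, ((pairFam S K).str i).add u (w 0) = w 1 ∧
        ¬ P i (vcons u fun j => w (j + 2)) :=
    .or (.of_bdd (.lt (.var 1) (.var 0))) (.ex (R := fun i u w =>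
        ((pairFam S K).str i).add u (w 0) = w 1 ∧ ¬ P i (vcons u fun j => w (j + 2)))
      (.and (.of_bdd (.eq (.add (.var 0) (.var 1)) (.var 2)))
        (hP.not.subst (.vcons (.var 0) (.shift 3)))))
  refine hM.hier hQ (vcons (e.j a) v) (S.add a S.one) h₁ (fun z _ => h₂ z) (e.j a) ?_
  rw [e.add, e.one]
  exact hK.lt_succ_self _

theorem iSigma_of_endExt (h : PAminus S) (hp : IsProper e) (hE : IsEndExt e)
    (he : SigmaElem e (n + 2)) (hM : MISigma e (n + 1)) : ISigma S (n + 2) := by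
  refine ⟨h, fun φ hφ v x h0 hs a => ?_⟩
  have hK := he.paMinus h
  have hF : ∀ i, PAminus ((pairFam S K).str i) := by
    rintro (_ | _)
    · exact hK
    · exact h
  have hcl : BddClosed (pairFam S K) n := by
    refine .of_coll hF fun j hj i => ?_
    cases i
    · exact (he.collAt h hp hE hj.le).2 hj
    · exact (he.collAt h hp hE hj.le).1
  have hclS : BddClosed ((pairFam S K).reindex fun _ : Unit => true) (n + 1) := by
    refine .of_coll (fun _ => h) fun j hj _ P hP v a hyp => ?_
    obtain ⟨Q, hQ, hQP⟩ := hP.extend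
    have := (he.collAt h hp hE (Nat.le_of_lt_succ hj)).1 Q hQ v a
    simp only [fun v => hQP () v] at this
    exact this hyp
  obtain ⟨R', hR', hTR⟩ := hclS.exists_normal (fun _ => h)
    ((Hier.of_isSigma hφ).subst (.updVar x))
  obtain ⟨R, hR, hRR⟩ := hR'.extend
  obtain ⟨ψ, hψ, hRψ⟩ := hcl.exists_normal_pi hF hR
  have hT : ∀ m, Sat0 S (upd v x m) φ ↔ ∃ y, R true (vcons y (vcons m v)) := fun m => by
    simp only [fun v => hRR () v]
    exact hTR () (vcons m v)
  obtain ⟨c, hc⟩ := not_forall.1 hp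
  let Φ : (pairFam S K).Pred := fun i w => ∃ y, ((pairFam S K).str i).lt y (w 1) ∧
    ∀ z, ((pairFam S K).str i).lt z (w 0) → ψ i (vcons z (vcons y fun j => w (j + 2)))
  have hΦ : Hier (pairFam S K) true n Φ :=
    hcl.bex (R := fun i y w => ∀ z, ((pairFam S K).str i).lt z (w 0) →
        ψ i (vcons z (vcons y fun j => w (j + 2)))) (.var 1)
      (hcl.ball (R := fun i z w => ψ i (vcons z (vcons (w 0) fun j => w (j + 3)))) (.var 1)
        (hψ.subst (.vcons (.var 0) (.vcons (.var 1) (.shift 4)))))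
  let v' : ℕ → K.M := fun j => e.j (v j)
  have key : ∀ m, Sat0 S (upd v x m) φ ↔
      ∀ w, Φ false (vcons w (vcons c (vcons (e.j m) v'))) := by
    intro m
    rw [hT]
    constructor
    · rintro ⟨y, hy⟩ w
      have := (he.transfer (hR.mono (by omega)) _).1 hy
      rw [comp_vcons, comp_vcons, hRψ] at this
      exact ⟨e.j y, hE c hc y, fun z _ => this z⟩
    · contrapose!
      intro hn
      have hall : ∀ b, ∃ w, ¬ Φ true (vcons w (vcons b (vcons m v))) := by
        intro b
        obtain ⟨w, hw⟩ := (he.collAt h hp hE le_rfl).1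
          (fun i u => ¬ ψ i u) hψ.not (vcons m v) b fun y _ => by
            have := hn y
            rw [hRψ] at this
            push Not at this
            exact this
        refine ⟨w, ?_⟩
        rintro ⟨y, hy, hz⟩
        obtain ⟨z, hzw, hz'⟩ := hw y hy
        exact hz' (hz z hzw)
      have hΘ : Hier (pairFam S K) false (n + 2) fun i u => ∀ b, ∃ w, ¬ Φ i (vcons w (vcons b u)) :=
        .all (R := fun i b u => ∃ w, ¬ Φ i (vcons w (vcons b u)))
          (.swap (.ex (R := fun i w u => ¬ Φ i (vcons w (vcons (u 0) fun j => u (j + 1))))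
            (.swap (hΦ.not.subst (.vcons (.var 0) (.vcons (.var 1) (.shift 2)))))))
      have := (he.transfer hΘ (vcons m v)).1 hall c
      rw [comp_vcons] at this
      exact this
  rw [key]
  refine hM.hier_pi (P := fun i u => ∀ w, Φ i (vcons w (vcons (u 1) (vcons (u 0)
    fun j => u (j + 2))))) hK ?_ (vcons c v') a ?_ fun u hu hPu => ?_
  · exact .all (R := fun i w u => Φ i (vcons w (vcons (u 1) (vcons (u 0) fun j => u (j + 2)))))
      ((hΦ.subst (.vcons (.var 0) (.vcons (.var 2) (.vcons (.var 1) (.shift 3))))).cross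
        (Nat.lt_succ_self n))
  · have := (key _).1 h0
    rwa [e.zero] at this
  · obtain ⟨u, rfl, _⟩ := hE.exists_of_lt hK hu
    have := (key _).1 (hs u ((key u).2 hPu))
    rwa [e.add, e.one] at this

end Downward

section Induction

variable {S : Str} {q : ℕ → S.M} {n k : ℕ} {b : Bool}

/-- The family consisting of a single structure with parameters `q`. -/
abbrev unitFam (S : Str) (q : ℕ → S.M) : Fam := ⟨Unit, fun _ => S, fun _ => q⟩

theorem IndFor.hier (h : IndFor S (IsSigma n)) {P : (unitFam S q).Pred}
    (hP : Hier (unitFam S q) true n P) (v : ℕ → S.M) (h0 : P () (vcons S.zero v))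
    (hs : ∀ m, P () (vcons m v) → P () (vcons (S.add m S.one) v)) (m : S.M) :
    P () (vcons m v) := by
  obtain ⟨φ, hφ, hφP⟩ := hP.exists_fml
  have key : ∀ m, Sat0 S (upd (mergeVal (vcons S.zero v) q) 1 m) φ ↔ P () (vcons m v) := fun m => by
    rw [← mergeVal_upd_var v q S.zero m]
    exact hφP () _ (mergeVal_upd_par _ _ _)
  have := h φ hφ (mergeVal (vcons S.zero v) q) 1
  simp only [key] at this
  exact this h0 hs m

theorem ISigma.bounded_induction (h : ISigma S (n + 1)) {P : (unitFam S q).Pred}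
    (hP : Hier (unitFam S q) b (n + 1) P) (v : ℕ → S.M) (a : S.M) (h0 : P () (vcons S.zero v))
    (hs : ∀ u, S.lt u a → P () (vcons u v) → P () (vcons (S.add u S.one) v)) :
    P () (vcons a v) := by
  have hp := h.1
  have key : ∀ {P : (unitFam S q).Pred}, Hier (unitFam S q) true (n + 1) P → ∀ v : ℕ → S.M,
      P () (vcons S.zero v) →
      (∀ u, S.lt u a → P () (vcons u v) → P () (vcons (S.add u S.one) v)) →
      P () (vcons a v) := by
    intro P hP v h0 hs
    have hQ : Hier (unitFam S q) true (n + 1) fun i w =>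
        S.lt (w 1) (w 0) ∨ P i (vcons (w 0) fun j => w (j + 2)) :=
      .or (.of_bdd (.lt (.var 1) (.var 0))) (hP.subst (.vcons (.var 0) (.shift 2)))
    refine (h.2.hier hQ (vcons a v) (.inr h0) ?_ a).resolve_left (hp.lt_irrefl a)
    rintro m (hm | hm)
    · exact .inl (hp.lt_trans _ _ _ hm (hp.lt_succ_self m))
    · rcases hp.lt_total m a with hma | rfl | hma
      · exact .inr (hs m hma hm)
      · exact .inl (hp.lt_succ_self m)
      · exact .inl (hp.lt_trans _ _ _ hma (hp.lt_succ_self m))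
  cases b
  · refine hp.reverse_induction (fun u => P () (vcons u v)) a (fun h₁ h₂ => ?_) h0 hs
    have hQ : Hier (unitFam S q) true (n + 1) fun i w =>
        S.lt (w 1) (w 0) ∨ ∃ u, S.add u (w 0) = w 1 ∧ ¬ P i (vcons u fun j => w (j + 2)) :=
      .or (.of_bdd (.lt (.var 1) (.var 0))) (.ex (F := unitFam S q) (R := fun i u w =>
          S.add u (w 0) = w 1 ∧ ¬ P i (vcons u fun j => w (j + 2)))
        (.and (.of_bdd (.eq (.add (.var 0) (.var 1)) (.var 2)))
          (hP.not.subst (.vcons (.var 0) (.shift 3)))))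
    exact key hQ (vcons a v) h₁ fun z _ => h₂ z
  · exact key hP v h0 hs

theorem ISigma.collAt (h : ISigma S (n + 1)) (hk : k ≤ n) : CollAt (unitFam S q) () k := by
  induction k using Nat.strong_induction_on with
  | _ k ih =>
  have hcl : BddClosed (unitFam S q) k :=
    .of_coll (fun _ => h.1) fun j hj _ => ih j hj (by omega)
  intro P hP v a hyp
  refine h.bounded_induction ((hP.collPred hcl).mono (by omega)) v a
    ⟨S.zero, fun x hx => absurd hx (h.1.not_lt_zero x)⟩ ?_
  rintro u hu ⟨b, hb⟩
  obtain ⟨y, hy⟩ := hyp u hu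
  obtain ⟨c, hbc, hyc⟩ := h.1.exists_gt_both b y
  refine ⟨c, fun x hx => ?_⟩
  rcases h.1.lt_succ_iff.1 hx with hx | rfl
  · obtain ⟨z, hz, hP⟩ := hb x hx
    exact ⟨z, h.1.lt_trans _ _ _ hz hbc, hP⟩
  · exact ⟨y, hyc, hy⟩

theorem ISigma.bddClosed (h : ISigma S (n + 1)) (hk : k ≤ n + 1) : BddClosed (unitFam S q) k :=
  .of_coll (fun _ => h.1) fun _ hj _ => h.collAt (by omega)

/-- `a` is the least element satisfying `P`. -/
def LeastAt (S : Str) (P : S.M → Prop) (a : S.M) : Prop := P a ∧ ∀ x, S.lt x a → ¬ P x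

theorem LeastAt.unique (h : PAminus S) {P : S.M → Prop} {x y : S.M} (hx : LeastAt S P x)
    (hy : LeastAt S P y) : x = y := by
  rcases h.lt_total x y with hxy | hxy | hxy
  · exact absurd hx.1 (hy.2 x hxy)
  · exact hxy
  · exact absurd hy.1 (hx.2 y hxy)

theorem ISigma.exists_least (h : ISigma S (n + 1)) {P : (unitFam S q).Pred}
    (hP : Hier (unitFam S q) b (n + 1) P) (v : ℕ → S.M) (hex : ∃ m, P () (vcons m v)) :
    ∃ m, LeastAt S (fun x => P () (vcons x v)) m := by
  by_contra hn
  have hlt : Hier (unitFam S q) (!b) (n + 1) fun i w =>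
      ∀ x, S.lt x (w 0) → ¬ P i (vcons x fun j => w (j + 1)) :=
    (h.bddClosed le_rfl).ball (R := fun i x w => ¬ P i (vcons x fun j => w (j + 1))) (.var 0)
      (hP.not.subst (.vcons (.var 0) (.shift 2)))
  obtain ⟨m, hm⟩ := hex
  exact hn ⟨m, hm, h.bounded_induction hlt v m (fun x hx => absurd hx (h.1.not_lt_zero x))
    fun u _ hu x hx => (h.1.lt_succ_iff.1 hx).elim (hu x) fun e hx' => hn ⟨u, e ▸ hx', hu⟩⟩

/-- Uniformization of `Σₙ₊₁` relations. -/
theorem ISigma.exists_uniformization (h : ISigma S (n + 1)) {P : (unitFam S q).Pred}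
    (hP : Hier (unitFam S q) true (n + 1) P) :
    ∃ G : (unitFam S q).Pred, Hier (unitFam S q) true (n + 1) G ∧ ∀ v, (∃ x, P () (vcons x v)) →
      ∃ x, P () (vcons x v) ∧ ∀ y, G () (vcons y v) ↔ y = x := by
  have hcl : BddClosed (unitFam S q) n := h.bddClosed (by omega)
  obtain ⟨R, hR, hPR⟩ := hcl.exists_normal (fun _ => h.1) hP
  let T : (unitFam S q).Pred := fun i w => S.lt (w 0) (w 1) ∧
    ∃ y, S.lt y (w 1) ∧ R i (vcons y (vcons (w 0) fun j => w (j + 2)))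
  have hT : Hier (unitFam S q) false n T := .and (.of_bdd (.lt (.var 0) (.var 1)))
    (hcl.bex (F := unitFam S q) (R := fun i y w => R i (vcons y (vcons (w 0) fun j => w (j + 2))))
      (.var 1) (hR.subst (.vcons (.var 0) (.vcons (.var 1) (.shift 3)))))
  let E : (unitFam S q).Pred := fun i w => ∃ x, S.lt x (w 0) ∧ T i (vcons x w)
  have hE : Hier (unitFam S q) false n E :=
    hcl.bex (F := unitFam S q) (R := fun i x w => T i (vcons x w)) (.var 0)
      (hT.subst (.vcons (.var 0) (.shift 1)))
  have hleast : ∀ {Q : (unitFam S q).Pred}, Hier (unitFam S q) false n Q →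
      Hier (unitFam S q) true (n + 1) fun i w =>
        LeastAt S (fun x => Q i (vcons x fun j => w (j + 1))) (w 0) := fun {Q} hQ =>
    .and (.swap (hQ.subst (.vcons (.var 0) (.shift 1))))
      ((hcl.ball (F := unitFam S q) (R := fun i x w => ¬ Q i (vcons x fun j => w (j + 1))) (.var 0)
        (hQ.not.subst (.vcons (.var 0) (.shift 2)))).mono (by omega))
  refine ⟨fun i w => ∃ b, LeastAt S (fun b => E i (vcons b fun j => w (j + 1))) b ∧
      LeastAt S (fun x => T i (vcons x (vcons b fun j => w (j + 1)))) (w 0),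
    .ex (F := unitFam S q) (R := fun i b w =>
        LeastAt S (fun b => E i (vcons b fun j => w (j + 1))) b ∧
        LeastAt S (fun x => T i (vcons x (vcons b fun j => w (j + 1)))) (w 0))
      (.and ((hleast hE).subst (.vcons (.var 0) (.shift 2)))
        ((hleast hT).subst (.vcons (.var 1) (.vcons (.var 0) (.shift 2))))), fun v => ?_⟩
  rintro ⟨x, hx⟩
  obtain ⟨y, hy⟩ := (hPR () _).1 hx
  obtain ⟨c, hxc, hyc⟩ := h.1.exists_gt_both x y
  obtain ⟨b, hb⟩ := h.exists_least (hE.cross (b' := true) (Nat.lt_succ_self n)) v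
    ⟨c, x, hxc, hxc, y, hyc, hy⟩
  obtain ⟨z, hz, hTz⟩ := hb.1
  obtain ⟨x', hx'⟩ := h.exists_least (hT.cross (b' := true) (Nat.lt_succ_self n)) (vcons b v)
    ⟨z, hTz⟩
  obtain ⟨y', _, hy'⟩ := hx'.1.2
  refine ⟨x', (hPR () _).2 ⟨y', hy'⟩, fun u => ⟨?_, ?_⟩⟩
  · rintro ⟨b', hb', hu⟩
    obtain rfl := hb'.unique h.1 hb
    exact hu.unique h.1 hx'
  · rintro rfl
    exact ⟨b, hb, hx'⟩

theorem TermFn.const (hq : Function.Surjective q) (a : S.M) :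
    TermFn (unitFam S q) fun _ _ => a := by
  obtain ⟨c, rfl⟩ := hq a
  exact .par c

end Induction

section Countability

/-- A numerical code of a term. -/
def Term.code : Term → ℕ
  | .var i => Nat.pair 0 i
  | .zero => Nat.pair 1 0
  | .one => Nat.pair 2 0
  | .add t u => Nat.pair 3 (Nat.pair t.code u.code)
  | .mul t u => Nat.pair 4 (Nat.pair t.code u.code)

theorem Term.code_injective : Function.Injective Term.code := by
  intro t
  induction t with
  | add t u h₁ h₂ | mul t u h₁ h₂ =>
    rintro (_ | _ | _ | _ | _) h <;> simp only [code, Nat.pair_eq_pair] at h <;>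
      first | omega | rw [h₁ h.2.1, h₂ h.2.2]
  | _ => rintro (_ | _ | _ | _ | _) h <;> simp_all [code, Nat.pair_eq_pair]

/-- A numerical code of a formula. -/
def Fml.code : Fml → ℕ
  | .eq t u => Nat.pair 0 (Nat.pair t.code u.code)
  | .lt t u => Nat.pair 1 (Nat.pair t.code u.code)
  | .mem t i => Nat.pair 2 (Nat.pair t.code i)
  | .not φ => Nat.pair 3 φ.code
  | .and φ ψ => Nat.pair 4 (Nat.pair φ.code ψ.code)
  | .or φ ψ => Nat.pair 5 (Nat.pair φ.code ψ.code)
  | .imp φ ψ => Nat.pair 6 (Nat.pair φ.code ψ.code)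
  | .all x φ => Nat.pair 7 (Nat.pair x φ.code)
  | .ex x φ => Nat.pair 8 (Nat.pair x φ.code)
  | .ball x t φ => Nat.pair 9 (Nat.pair x (Nat.pair t.code φ.code))
  | .bex x t φ => Nat.pair 10 (Nat.pair x (Nat.pair t.code φ.code))
  | .sall x φ => Nat.pair 11 (Nat.pair x φ.code)
  | .sex x φ => Nat.pair 12 (Nat.pair x φ.code)

theorem Fml.code_injective : Function.Injective Fml.code := by
  intro φ
  induction φ <;>
    rintro (_ | _ | _ | _ | _ | _ | _ | _ | _ | _ | _ | _ | _) h <;>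
    simp only [code, Nat.pair_eq_pair, Term.code_injective.eq_iff] at h <;>
    first | omega | grind

instance : Countable Fml := Fml.code_injective.countable

/-- Binary `Σₙ₊₁`-definable relations. -/
def Def₂ (S : Str) (q : ℕ → S.M) (n : ℕ) (B : S.M → S.M → Prop) : Prop :=
  Hier (unitFam S q) true (n + 1) fun _ v => B (v 0) (v 1)

theorem countable_def₂ (S : Str) (q : ℕ → S.M) (n : ℕ) : Countable {B // Def₂ S q n B} := by
  let f : Fml → S.M → S.M → Prop := fun φ x y =>
    Sat0 S (mergeVal (vcons x (vcons y fun _ => S.zero)) q) φ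
  have : {B | Def₂ S q n B} ⊆ Set.range f := by
    intro B hB
    obtain ⟨φ, -, h⟩ := Hier.exists_fml hB
    refine ⟨φ, funext fun x => funext fun y => propext ?_⟩
    have := h () _ (mergeVal_par (vcons x (vcons y fun _ => S.zero)) q)
    simp only [mergeVal_var] at this
    exact this
  exact ((Set.countable_range f).mono this).to_subtype

end Countability

section Generic

variable {S : Str} {q : ℕ → S.M} {n : ℕ}

/-- `Σₙ₊₁`-definable unbounded sets. -/
structure LargeSet (S : Str) (q : ℕ → S.M) (n : ℕ) where
  carrier : S.M → Prop
  hier : Hier (unitFam S q) true (n + 1) fun _ v => carrier (v 0)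
  unbounded : ∀ b, ∃ i, S.lt b i ∧ carrier i

theorem ISigma.exists_refine (h : ISigma S (n + 2)) (hq : Function.Surjective q)
    (A : LargeSet S q n) (B : {B // Def₂ S q n B} × S.M) :
    ∃ A' : LargeSet S q n, (∀ i, A'.carrier i → A.carrier i) ∧
      ∃ u, (∀ x, S.lt x u → ∀ i, A'.carrier i → B.1.1 x i) ∧
        (u = B.2 ∨ S.lt u B.2 ∧ ∃ b, ∀ i, S.lt b i → A'.carrier i → ¬ B.1.1 u i) := by
  obtain ⟨⟨B, hB⟩, a⟩ := B
  have hcl : BddClosed (unitFam S q) (n + 1) := h.bddClosed (by omega)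
  have hsub : Hier (unitFam S q) true (n + 1) fun _ w =>
      A.carrier (w 0) ∧ ∀ x, S.lt x (w 1) → B x (w 0) :=
    .and A.hier
      (hcl.ball (F := unitFam S q) (R := fun _ x w => B x (w 0)) (.var 1) hB)
  have hQ : Hier (unitFam S q) false (n + 2) fun _ w =>
      ∀ b, ∃ i, S.lt b i ∧ A.carrier i ∧ ∀ x, S.lt x (w 0) → B x i :=
    .all (F := unitFam S q)
      (R := fun _ b w => ∃ i, S.lt b i ∧ A.carrier i ∧ ∀ x, S.lt x (w 0) → B x i)
      (.swap (.ex (F := unitFam S q)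
        (R := fun _ i w => S.lt (w 0) i ∧ A.carrier i ∧ ∀ x, S.lt x (w 1) → B x i)
        (.and (.of_bdd (.lt (.var 1) (.var 0)))
          (hsub.subst (.vcons (.var 0) (.vcons (.var 2) (.shift 3)))))))
  let refined : ∀ u, (∀ b, ∃ i, S.lt b i ∧ A.carrier i ∧ ∀ x, S.lt x u → B x i) →
      LargeSet S q n := fun u hu =>
    ⟨fun i => A.carrier i ∧ ∀ x, S.lt x u → B x i,
      hsub.subst (.vcons (.var 0) (.vcons (.const hq u) (.shift 1))), hu⟩
  by_cases hstep : ∀ u, S.lt u a →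
      (∀ b, ∃ i, S.lt b i ∧ A.carrier i ∧ ∀ x, S.lt x u → B x i) →
      ∀ b, ∃ i, S.lt b i ∧ A.carrier i ∧ ∀ x, S.lt x (S.add u S.one) → B x i
  · have ha := h.bounded_induction hQ (fun _ => S.zero) a (fun b => by
      obtain ⟨i, hi, hA⟩ := A.unbounded b
      exact ⟨i, hi, hA, fun x hx => absurd hx (h.1.not_lt_zero x)⟩) hstep
    exact ⟨refined a ha, fun i hi => hi.1, a, fun x hx i hi => hi.2 x hx, .inl rfl⟩
  · push Not at hstep
    obtain ⟨u, hua, hu, b, hb⟩ := hstep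
    refine ⟨refined u hu, fun i hi => hi.1, u, fun x hx i hi => hi.2 x hx,
      .inr ⟨hua, b, fun i hbi hi hBu => ?_⟩⟩
    obtain ⟨x, hx, hBx⟩ := hb i hbi hi.1
    rcases h.1.lt_succ_iff.1 hx with hx | rfl
    · exact hBx (hi.2 x hx)
    · exact hBx hBu

/-- A nonprincipal ultrafilter along which bounded induction for `Σₙ₊₁` relations holds. -/
structure Generic (S : Str) (q : ℕ → S.M) (n : ℕ) (U : Ultrafilter S.M) : Prop where
  tail : ∀ b, ∀ᶠ i in (U : Filter S.M), S.lt b i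
  induction : ∀ B, Def₂ S q n B → ∀ a, (∀ᶠ i in (U : Filter S.M), B S.zero i) →
    (∀ x, S.lt x a → (∀ᶠ i in (U : Filter S.M), B x i) →
      ∀ᶠ i in (U : Filter S.M), B (S.add x S.one) i) →
    ∀ x, S.lt x a → ∀ᶠ i in (U : Filter S.M), B x i

theorem ISigma.exists_generic (h : ISigma S (n + 2)) (hq : Function.Surjective q) :
    ∃ U : Ultrafilter S.M, Generic S q n U := by
  have hc : Countable S.M := hq.countable
  have hc₂ := countable_def₂ S q n
  have : Nonempty ({B // Def₂ S q n B} × S.M) :=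
    ⟨⟨fun _ _ => S.zero = S.zero, .of_bdd (.eq .zero .zero)⟩, S.zero⟩
  obtain ⟨task, htask⟩ := exists_surjective_nat ({B // Def₂ S q n B} × S.M)
  choose next hle hnext using h.exists_refine hq
  let A₀ : LargeSet S q n := ⟨fun _ => S.zero = S.zero, .of_bdd (.eq .zero .zero),
    fun b => ⟨_, h.1.lt_succ_self b, rfl⟩⟩
  let A : ℕ → LargeSet S q n := fun k => Nat.rec A₀ (fun k B => next B (task k)) k
  have hA : ∀ {k l}, k ≤ l → ∀ i, (A l).carrier i → (A k).carrier i := by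
    intro k l hkl
    induction hkl with
    | refl => exact fun _ h => h
    | step _ ih => exact fun i hi => ih i (hle _ _ i hi)
  let V : Filter S.M :=
    { sets := {X | ∃ k b, ∀ i, (A k).carrier i → S.lt b i → i ∈ X}
      univ_sets := ⟨0, S.zero, fun _ _ _ => trivial⟩
      sets_of_superset := fun ⟨k, b, h⟩ hXY => ⟨k, b, fun i h₁ h₂ => hXY (h i h₁ h₂)⟩
      inter_sets := by
        rintro X Y ⟨k, b, hX⟩ ⟨l, c, hY⟩
        obtain ⟨d, hbd, hcd⟩ := h.1.exists_gt_both b c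
        exact ⟨max k l, d, fun i h₁ h₂ =>
          ⟨hX i (hA (le_max_left k l) i h₁) (h.1.lt_trans _ _ _ hbd h₂),
            hY i (hA (le_max_right k l) i h₁) (h.1.lt_trans _ _ _ hcd h₂)⟩⟩ }
  have hV : V.NeBot := by
    refine Filter.neBot_iff.2 fun hbot => ?_
    obtain ⟨k, b, hk⟩ : ∅ ∈ V := Filter.empty_mem_iff_bot.2 hbot
    obtain ⟨i, hbi, hi⟩ := (A k).unbounded b
    exact hk i hi hbi
  have hUV : ∀ {p : S.M → Prop}, (∃ k b, ∀ i, (A k).carrier i → S.lt b i → p i) →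
      ∀ᶠ i in (Ultrafilter.of V : Filter S.M), p i := fun hp => Ultrafilter.of_le V hp
  refine ⟨.of V, fun b => hUV ⟨0, b, fun i _ hi => hi⟩, fun B hB a h0 hs => ?_⟩
  obtain ⟨k, hk⟩ := htask (⟨B, hB⟩, a)
  obtain ⟨u, hu, hua⟩ := hnext (A k) (task k)
  rw [hk] at hu hua
  have hlt : ∀ x, S.lt x u → ∀ᶠ i in (Ultrafilter.of V : Filter S.M), B x i := fun x hx =>
    hUV ⟨k + 1, S.zero, fun i hi _ => hu x hx i (by simpa only [← hk] using hi)⟩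
  rcases hua with rfl | ⟨hua, b, hb⟩
  · exact hlt
  · have hnot : ∀ᶠ i in (Ultrafilter.of V : Filter S.M), ¬ B u i :=
      hUV ⟨k + 1, b, fun i hi hbi => hb i hbi (by simpa only [← hk] using hi)⟩
    have hyes : ∀ᶠ i in (Ultrafilter.of V : Filter S.M), B u i := by
      rcases h.1.zero_le u with rfl | hpos
      · exact h0
      · obtain ⟨x, rfl⟩ := h.1.pred u hpos
        have hx := h.1.lt_succ_self x
        exact hs x (h.1.lt_trans _ _ _ hx hua) (hlt x hx)
    obtain ⟨i, h₁, h₂⟩ := (hnot.and hyes).exists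
    exact absurd h₂ h₁

end Generic

section DefinableFunctions

variable {S : Str} {q : ℕ → S.M} {n : ℕ} {U : Ultrafilter S.M}

/-- Functions whose graph coincides with a `Σₙ₊₁`-definable relation almost everywhere. -/
def EvDef (S : Str) (q : ℕ → S.M) (n : ℕ) (U : Ultrafilter S.M) (f : S.M → S.M) : Prop :=
  ∃ G, Def₂ S q n G ∧ ∀ᶠ i in (U : Filter S.M), ∀ y, G i y ↔ f i = y

theorem EvDef.exists_def₂_aux {P : (unitFam S q).Pred} (hP : Hier (unitFam S q) true (n + 1) P)
    {f : ℕ → S.M → S.M} (hf : ∀ j, EvDef S q n U (f j)) (N : ℕ)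
    (hN : ∀ v v' : ℕ → S.M, (∀ j < N + 2, v j = v' j) → (P () v ↔ P () v')) :
    ∃ B, Def₂ S q n B ∧ ∀ᶠ i in (U : Filter S.M), ∀ m,
      P () (vcons i (vcons m fun j => f j i)) ↔ B i m := by
  induction N generalizing P f with
  | zero =>
    refine ⟨fun i m => P () (vcons i (vcons m fun _ => S.zero)),
      hP.subst (.vcons (.var 0) (.vcons (.var 1) fun _ => .zero)),
      .of_forall fun i m => hN _ _ ?_⟩
    rintro (_ | _ | j) hj
    · rfl
    · rfl
    · omega
  | succ N ih =>
    obtain ⟨G, hG, hGf⟩ := hf 0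
    have hQ : Hier (unitFam S q) true (n + 1) fun _ w => ∃ y, G (w 0) y ∧
        P () (vcons (w 0) (vcons (w 1) (vcons y fun j => w (j + 2)))) :=
      .ex (F := unitFam S q) (R := fun _ y w => G (w 0) y ∧
          P () (vcons (w 0) (vcons (w 1) (vcons y fun j => w (j + 2)))))
        (.and (Hier.subst hG (.vcons (.var 1) (.vcons (.var 0) (.shift 2))))
          (hP.subst (.vcons (.var 1) (.vcons (.var 2) (.vcons (.var 0) (.shift 3))))))
    obtain ⟨B, hB, hPB⟩ := ih hQ (f := fun j => f (j + 1)) (fun j => hf (j + 1))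
      fun v v' hv => by
        have h0 := hv 0 (by omega)
        dsimp only
        rw [h0]
        refine exists_congr fun y => and_congr_right fun _ => hN _ _ ?_
        rintro (_ | _ | _ | j) hj
        · rfl
        · exact hv 1 (by omega)
        · rfl
        · exact hv (j + 2) (by omega)
    refine ⟨B, hB, ?_⟩
    filter_upwards [hGf, hPB] with i h₁ h₂ m
    rw [← h₂]
    have heta := vcons_eta fun j => f j i
    constructor
    · intro hp
      exact ⟨f 0 i, (h₁ _).2 rfl, heta.symm ▸ hp⟩
    · rintro ⟨y, hy, hp⟩
      obtain rfl := (h₁ y).1 hy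
      rw [← heta]
      exact hp

/-- Substituting functions into a `Σₙ₊₁` predicate yields a `Σₙ₊₁` relation. -/
theorem EvDef.exists_def₂ {P : (unitFam S q).Pred} (hP : Hier (unitFam S q) true (n + 1) P)
    {f : ℕ → S.M → S.M} (hf : ∀ j, EvDef S q n U (f j)) :
    ∃ B, Def₂ S q n B ∧ ∀ᶠ i in (U : Filter S.M), ∀ m,
      P () (vcons m fun j => f j i) ↔ B i m := by
  have hP' := hP.shift
  obtain ⟨N, hN⟩ := hP'.support
  exact exists_def₂_aux hP' hf N fun v v' hv => hN () v v' fun j hj => hv j (by omega)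

theorem EvDef.const (hq : Function.Surjective q) (a : S.M) : EvDef S q n U fun _ => a :=
  ⟨fun _ y => a = y, .of_bdd (.eq (.const hq a) (.var 1)), .of_forall fun _ _ => Iff.rfl⟩

theorem EvDef.id : EvDef S q n U fun i => i :=
  ⟨fun i y => i = y, .of_bdd (.eq (.var 0) (.var 1)), .of_forall fun _ _ => Iff.rfl⟩

theorem EvDef.comp₂ {op : S.M → S.M → S.M}
    (hop : TermFn (unitFam S q) fun _ w => op (w 1) (w 2)) {f g : S.M → S.M}
    (hf : EvDef S q n U f) (hg : EvDef S q n U g) : EvDef S q n U fun i => op (f i) (g i) := by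
  obtain ⟨B, hB, h⟩ := exists_def₂ (P := fun _ w => op (w 1) (w 2) = w 0)
    (.of_bdd (.eq hop (.var 0))) (f := vcons f fun _ => g) (by rintro (_ | j) <;> assumption)
  refine ⟨B, hB, ?_⟩
  filter_upwards [h] with i hi y
  exact (hi y).symm

/-- Bounded induction along a generic ultrafilter. -/
theorem Generic.induction' (hU : Generic S q n U) {P : (unitFam S q).Pred}
    (hP : Hier (unitFam S q) true (n + 1) P) {f : ℕ → S.M → S.M}
    (hf : ∀ j, EvDef S q n U (f j)) (a : S.M)
    (h0 : ∀ᶠ i in (U : Filter S.M), P () (vcons S.zero fun j => f j i))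
    (hs : ∀ x, S.lt x a → (∀ᶠ i in (U : Filter S.M), P () (vcons x fun j => f j i)) →
      ∀ᶠ i in (U : Filter S.M), P () (vcons (S.add x S.one) fun j => f j i)) (x : S.M)
    (hx : S.lt x a) : ∀ᶠ i in (U : Filter S.M), P () (vcons x fun j => f j i) := by
  obtain ⟨B, hB, hPB⟩ := EvDef.exists_def₂ hP hf
  have key : ∀ x, (∀ᶠ i in (U : Filter S.M), P () (vcons x fun j => f j i)) ↔
      ∀ᶠ i in (U : Filter S.M), B i x := fun x =>
    Filter.eventually_congr (hPB.mono fun i hi => hi x)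
  simp only [key] at h0 hs ⊢
  exact hU.induction (fun x i => B i x)
    (Hier.subst hB (.vcons (.var 1) (.vcons (.var 0) (.shift 2)))) a h0 hs x hx

/-- A function bounded by a constant is almost everywhere constant. -/
theorem Generic.exists_const (hU : Generic S q n U) (h : PAminus S) {f : S.M → S.M}
    (hf : EvDef S q n U f) {a : S.M} (ha : ∀ᶠ i in (U : Filter S.M), S.lt (f i) a) :
    ∃ c, S.lt c a ∧ ∀ᶠ i in (U : Filter S.M), f i = c := by
  by_contra! hn
  have := hU.induction' (P := fun _ w => ¬ S.lt (w 1) (w 0))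
    (.of_bdd (.not (.lt (.var 1) (.var 0)))) (fun _ : ℕ => hf) (S.add a S.one)
    (.of_forall fun i => h.not_lt_zero _) (fun x hx hxi => ?_) a (h.lt_succ_self a)
  · obtain ⟨i, h₁, h₂⟩ := (this.and ha).exists
    exact h₁ h₂
  · rcases h.lt_succ_iff.1 hx with hx | rfl
    · filter_upwards [hxi, hn x hx] with i h₁ h₂ h₃
      exact (h.lt_succ_iff.1 h₃).elim h₁ h₂
    · obtain ⟨i, h₁, h₂⟩ := (hxi.and ha).exists
      exact absurd h₂ h₁

/-- A realization of the ultrapower of `S` restricted to functions in `EvDef S q n U`, together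
with a choice of representatives. -/
structure Ultrapower (S : Str) (q : ℕ → S.M) (n : ℕ) (U : Ultrafilter S.M) : Type 1 where
  K : Str
  rep : K.M → S.M → S.M
  rep_def : ∀ x, EvDef S q n U (rep x)
  exists_rep : ∀ f, EvDef S q n U f → ∃ x, ∀ᶠ i in (U : Filter S.M), rep x i = f i
  eq_iff : ∀ x y, x = y ↔ ∀ᶠ i in (U : Filter S.M), rep x i = rep y i
  lt_iff : ∀ x y, K.lt x y ↔ ∀ᶠ i in (U : Filter S.M), S.lt (rep x i) (rep y i)
  rep_zero : ∀ᶠ i in (U : Filter S.M), rep K.zero i = S.zero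
  rep_one : ∀ᶠ i in (U : Filter S.M), rep K.one i = S.one
  rep_add : ∀ x y, ∀ᶠ i in (U : Filter S.M), rep (K.add x y) i = S.add (rep x i) (rep y i)
  rep_mul : ∀ x y, ∀ᶠ i in (U : Filter S.M), rep (K.mul x y) i = S.mul (rep x i) (rep y i)

theorem nonempty_ultrapower (S : Str) (q : ℕ → S.M) (n : ℕ) (U : Ultrafilter S.M)
    (hq : Function.Surjective q) : Nonempty (Ultrapower S q n U) := by
  let M : Type := {g : (U : Filter S.M).Germ S.M // ∃ f, EvDef S q n U f ∧ (f : Filter.Germ _ _) = g}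
  choose rep hdef hrep using fun x : M => x.2
  have hadd : ∀ x y : M, EvDef S q n U fun i => S.add (rep x i) (rep y i) := fun x y =>
    .comp₂ (.add (.var 1) (.var 2)) (hdef x) (hdef y)
  have hmul : ∀ x y : M, EvDef S q n U fun i => S.mul (rep x i) (rep y i) := fun x y =>
    .comp₂ (.mul (.var 1) (.var 2)) (hdef x) (hdef y)
  let cls : ∀ f, EvDef S q n U f → M := fun f hf => ⟨f, f, hf, rfl⟩
  have hcls : ∀ f hf, ∀ᶠ i in (U : Filter S.M), rep (cls f hf) i = f i := fun f hf =>
    Filter.Germ.coe_eq.1 (hrep (cls f hf))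
  exact ⟨{
    K := {
      M := M
      zero := cls _ (.const hq S.zero)
      one := cls _ (.const hq S.one)
      add := fun x y => cls _ (hadd x y)
      mul := fun x y => cls _ (hmul x y)
      lt := fun x y => ∀ᶠ i in (U : Filter S.M), S.lt (rep x i) (rep y i) }
    rep := rep
    rep_def := hdef
    exists_rep := fun f hf => ⟨cls f hf, hcls f hf⟩
    eq_iff := fun x y => by
      rw [Subtype.ext_iff, ← hrep x, ← hrep y]
      exact Filter.Germ.coe_eq
    lt_iff := fun _ _ => Iff.rfl
    rep_zero := hcls (fun _ => S.zero) (.const hq S.zero)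
    rep_one := hcls (fun _ => S.one) (.const hq S.one)
    rep_add := fun x y => hcls _ (hadd x y)
    rep_mul := fun x y => hcls _ (hmul x y) }⟩

end DefinableFunctions

section Restriction

variable {S K : Str} {q : ℕ → S.M} {b : Bool} {k : ℕ}

theorem TermFn.restrict {t : (pairFam S K).Fn} (ht : TermFn (pairFam S K) t) :
    TermFn (unitFam S q) fun _ v => t true v := by
  induction ht with
  | var k => exact .var k
  | par c => exact .zero
  | zero => exact .zero
  | one => exact .one
  | add _ _ h₁ h₂ => exact .add h₁ h₂
  | mul _ _ h₁ h₂ => exact .mul h₁ h₂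

theorem BddPred.restrict {P : (pairFam S K).Pred} (hP : BddPred (pairFam S K) P) :
    BddPred (unitFam S q) fun _ v => P true v := by
  induction hP with
  | eq h₁ h₂ => exact .eq h₁.restrict h₂.restrict
  | lt h₁ h₂ => exact .lt h₁.restrict h₂.restrict
  | not _ h => exact .not h
  | and _ _ h₁ h₂ => exact .and h₁ h₂
  | ball' ht _ h => exact .ball' ht.restrict h

theorem Hier.restrict {P : (pairFam S K).Pred} (hP : Hier (pairFam S K) b k P) :
    Hier (unitFam S q) b k fun _ v => P true v := by
  induction k generalizing b P with
  | zero => exact BddPred.restrict hP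
  | succ k ih =>
    induction hP with
    | base h => exact .base (ih h)
    | quant _ h => exact .quant h

end Restriction

section Los

variable {S : Str} {q : ℕ → S.M} {n : ℕ} {U : Ultrafilter S.M}

theorem ISigma.of_succ (h : ISigma S (n + 1)) : ISigma S n := by
  refine ⟨h.1, fun φ hφ v x h0 hs m => ?_⟩
  have hP : Hier (unitFam S fun _ => S.zero) true n
      fun _ w => Sat0 S (upd (fun j => w (j + 1)) x (w 0)) φ :=
    (Hier.of_isSigma (F := unitFam S fun _ => S.zero) hφ).subst (.updVar x)
  exact h.2.hier hP.succ v h0 hs m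

/-- Existential quantifiers in front of `Σₙ₊₁` predicates are witnessed in the ultrapower. -/
theorem Ultrapower.exists_witness (A : Ultrapower S q n U) (h : ISigma S (n + 1))
    {P : (unitFam S q).Pred} (hP : Hier (unitFam S q) true (n + 1) P) (v : ℕ → A.K.M)
    (hv : ∀ᶠ i in (U : Filter S.M), ∃ m, P () (vcons m fun j => A.rep (v j) i)) :
    ∃ m, ∀ᶠ i in (U : Filter S.M), P () (vcons (A.rep m i) fun j => A.rep (v j) i) := by
  classical
  obtain ⟨G, hG, hGP⟩ := h.exists_uniformization hP
  obtain ⟨B, hB, hBG⟩ := EvDef.exists_def₂ hG fun j => A.rep_def (v j)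
  let f : S.M → S.M := fun i => if hi : ∃ y, ∀ m, B i m ↔ m = y then hi.choose else S.zero
  have hf : ∀ᶠ i in (U : Filter S.M), (∀ y, B i y ↔ f i = y) ∧
      P () (vcons (f i) fun j => A.rep (v j) i) := by
    filter_upwards [hv, hBG] with i h₁ h₂
    obtain ⟨x, hx, hGx⟩ := hGP _ h₁
    have hi : ∃ y, ∀ m, B i m ↔ m = y := ⟨x, fun m => (h₂ m).symm.trans (hGx m)⟩
    have hfi : f i = hi.choose := dif_pos hi
    have hfx : f i = x := by
      rw [hfi]
      exact ((hGx _).1 ((h₂ _).2 ((hi.choose_spec _).2 rfl)))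
    refine ⟨fun y => ?_, hfx ▸ hx⟩
    rw [hfi, hi.choose_spec, eq_comm]
  obtain ⟨m, hm⟩ := A.exists_rep f ⟨B, hB, hf.mono fun i hi => hi.1⟩
  refine ⟨m, ?_⟩
  filter_upwards [hf, hm] with i h₁ h₂
  rw [h₂]
  exact h₁.2

/-- Truth of `P` in the ultrapower is truth almost everywhere. -/
def Ultrapower.Los (A : Ultrapower S q n U) (P : (pairFam S A.K).Pred) : Prop :=
  ∀ v : ℕ → A.K.M, P false v ↔ ∀ᶠ i in (U : Filter S.M), P true fun j => A.rep (v j) i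

variable {A : Ultrapower S q n U} {P Q : (pairFam S A.K).Pred}

theorem Ultrapower.Los.not (hP : A.Los P) : A.Los fun i v => ¬ P i v := fun v =>
  (not_congr (hP v)).trans Ultrafilter.eventually_not.symm

theorem Ultrapower.Los.and (hP : A.Los P) (hQ : A.Los Q) : A.Los fun i v => P i v ∧ Q i v :=
  fun v => (and_congr (hP v) (hQ v)).trans Filter.eventually_and.symm

theorem Ultrapower.Los.of_iff (hP : A.Los P) (h : ∀ i v, Q i v ↔ P i v) : A.Los Q := by
  rwa [show Q = P from funext fun i => funext fun v => propext (h i v)]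

theorem Ultrapower.Los.imp_eventually (hP : A.Los P) {v : ℕ → A.K.M} {m : A.K.M} :
    P false (vcons m v) ↔
      ∀ᶠ i in (U : Filter S.M), P true (vcons (A.rep m i) fun j => A.rep (v j) i) :=
  (hP _).trans <| Filter.eventually_congr <| .of_forall fun i =>
    iff_of_eq (congrArg (P true) (comp_vcons (fun x => A.rep x i) m v))

theorem Ultrapower.Los.ex (h : ISigma S (n + 1)) (hP' : Hier (pairFam S A.K) true (n + 1) P)
    (hP : A.Los P) : A.Los fun i v => ∃ m, P i (vcons m v) := fun v =>
  ⟨fun ⟨_, hm⟩ => (hP.imp_eventually.1 hm).mono fun _ hi => ⟨_, hi⟩, fun hv =>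
    (A.exists_witness h (Hier.restrict (q := q) hP') v hv).imp fun _ hm => hP.imp_eventually.2 hm⟩

theorem TermFn.eventually_rep {t : (pairFam S A.K).Fn} (ht : TermFn (pairFam S A.K) t)
    (v : ℕ → A.K.M) :
    ∀ᶠ i in (U : Filter S.M), A.rep (t false v) i = t true fun j => A.rep (v j) i := by
  induction ht with
  | var k => exact .of_forall fun _ => rfl
  | par c => exact A.rep_zero
  | zero => exact A.rep_zero
  | one => exact A.rep_one
  | @add t u _ _ h₁ h₂ =>
    filter_upwards [A.rep_add (t false v) (u false v), h₁, h₂] with i h₀ h₁ h₂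
    rw [← h₁, ← h₂]
    exact h₀
  | @mul t u _ _ h₁ h₂ =>
    filter_upwards [A.rep_mul (t false v) (u false v), h₁, h₂] with i h₀ h₁ h₂
    rw [← h₁, ← h₂]
    exact h₀

theorem TermFn.los_lt {t u : (pairFam S A.K).Fn} (ht : TermFn (pairFam S A.K) t)
    (hu : TermFn (pairFam S A.K) u) :
    A.Los fun i v => ((pairFam S A.K).str i).lt (t i v) (u i v) := fun v =>
  (A.lt_iff _ _).trans <| Filter.eventually_congr <| by
    filter_upwards [ht.eventually_rep v, hu.eventually_rep v] with i h₁ h₂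
    rw [h₁, h₂]

theorem BddPred.los (h : ISigma S (n + 1)) (hP : BddPred (pairFam S A.K) P) : A.Los P := by
  induction hP with
  | @eq t u ht hu =>
    refine fun v => (A.eq_iff _ _).trans <| Filter.eventually_congr ?_
    filter_upwards [ht.eventually_rep v, hu.eventually_rep v] with i h₁ h₂
    rw [h₁, h₂]
  | lt ht hu => exact ht.los_lt hu
  | not _ hP => exact hP.not
  | and _ _ hP hQ => exact hP.and hQ
  | @ball' t P ht hP' hP =>
    have ht' := ht.subst (.shift 1)
    have := Ultrapower.Los.ex h (.of_bdd (.and (.lt (.var 0) ht') hP'.not))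
      ((TermFn.los_lt (.var 0) ht').and hP.not)
    refine this.not.of_iff fun i v => ?_
    push Not
    exact Iff.rfl

/-- Łoś's theorem for the restricted ultrapower. -/
theorem Hier.los {b : Bool} {k : ℕ} (h : ISigma S (n + 1)) (hk : k ≤ n + 1)
    (hP : Hier (pairFam S A.K) b k P) : A.Los P := by
  induction k generalizing b P with
  | zero => exact BddPred.los h hP
  | succ k ih =>
    induction hP with
    | base hP => exact ih (by omega) hP
    | @quant P hP' hP =>
      have hP' : Hier (pairFam S A.K) b (k + 1) P := hP'
      cases b
      · refine (Ultrapower.Los.ex h (hP'.not.mono hk) hP.not).not.of_iff fun i v => ?_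
        push Not
        exact Iff.rfl
      · exact Ultrapower.Los.ex h (hP'.mono hk) hP

end Los

section Extension

variable {S : Str} {q : ℕ → S.M} {n : ℕ} {U : Ultrafilter S.M}

theorem Ultrapower.exists_emb (A : Ultrapower S q n U)
    (hq : Function.Surjective q) :
    ∃ e : Emb S A.K, ∀ a, ∀ᶠ i in (U : Filter S.M), A.rep (e.j a) i = a := by
  choose j hj using fun a => A.exists_rep _ (.const hq a)
  have hlt : ∀ a b, S.lt a b ↔ A.K.lt (j a) (j b) := fun a b => by
    rw [A.lt_iff, ← Filter.eventually_const (f := (U : Filter S.M)) (p := S.lt a b)]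
    refine Filter.eventually_congr ?_
    filter_upwards [hj a, hj b] with i h₁ h₂
    rw [h₁, h₂]
  refine ⟨⟨j, fun a b hab => ?_, ?_, ?_, fun a b => ?_, fun a b => ?_, hlt⟩, hj⟩
  · obtain ⟨i, h₁, h₂⟩ := ((hj a).and (hj b)).exists
    rw [← h₁, hab, h₂]
  · rw [A.eq_iff]
    filter_upwards [hj S.zero, A.rep_zero] with i h₁ h₂
    rw [h₁, h₂]
  · rw [A.eq_iff]
    filter_upwards [hj S.one, A.rep_one] with i h₁ h₂
    rw [h₁, h₂]
  · rw [A.eq_iff]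
    filter_upwards [hj (S.add a b), hj a, hj b, A.rep_add (j a) (j b)] with i h₁ h₂ h₃ h₄
    rw [h₁, h₄, h₂, h₃]
  · rw [A.eq_iff]
    filter_upwards [hj (S.mul a b), hj a, hj b, A.rep_mul (j a) (j b)] with i h₁ h₂ h₃ h₄
    rw [h₁, h₄, h₂, h₃]

variable {A : Ultrapower S q n U} {e : Emb S A.K}

theorem Ultrapower.isProper (h : PAminus S) (hU : Generic S q n U)
    (he : ∀ a, ∀ᶠ i in (U : Filter S.M), A.rep (e.j a) i = a) : IsProper e := fun hs => by
  obtain ⟨x, hx⟩ := A.exists_rep _ .id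
  obtain ⟨a, rfl⟩ := hs x
  obtain ⟨i, ⟨h₁, h₂⟩, h₃⟩ := ((hx.and (he a)).and (hU.tail a)).exists
  rw [← h₁, h₂] at h₃
  exact h.lt_irrefl a h₃

theorem Ultrapower.exists_eq_of_lt (h : PAminus S) (hU : Generic S q n U)
    (he : ∀ a, ∀ᶠ i in (U : Filter S.M), A.rep (e.j a) i = a) {x : A.K.M} {a : S.M}
    (hx : ∀ᶠ i in (U : Filter S.M), S.lt (A.rep x i) a) : ∃ c, S.lt c a ∧ e.j c = x := by
  obtain ⟨c, hc, hxc⟩ := hU.exists_const h (A.rep_def x) hx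
  refine ⟨c, hc, (A.eq_iff _ _).2 ?_⟩
  filter_upwards [hxc, he c] with i h₁ h₂
  rw [h₁, h₂]

theorem Ultrapower.isEndExt (h : PAminus S) (hU : Generic S q n U)
    (he : ∀ a, ∀ᶠ i in (U : Filter S.M), A.rep (e.j a) i = a) : IsEndExt e := fun b hb a => by
  by_contra hab
  rw [A.lt_iff, ← Ultrafilter.eventually_not] at hab
  obtain ⟨c, -, hc⟩ := exists_eq_of_lt (x := b) (a := S.add a S.one) h hU he <| by
    filter_upwards [hab, he a] with i h₁ h₂
    rw [h₂] at h₁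
    exact h.not_lt_iff.1 h₁
  exact hb ⟨c, hc⟩

theorem Ultrapower.eventually_rep_emb (he : ∀ a, ∀ᶠ i in (U : Filter S.M), A.rep (e.j a) i = a)
    {P : (pairFam S A.K).Pred} {b : Bool} {k : ℕ} (hP : Hier (pairFam S A.K) b k P)
    (v : ℕ → S.M) :
    (∀ᶠ i in (U : Filter S.M), P true fun j => A.rep (e.j (v j)) i) ↔ P true v := by
  obtain ⟨N, hN⟩ := hP.support
  rw [← Filter.eventually_const (f := (U : Filter S.M)) (p := P true v)]
  refine Filter.eventually_congr ?_
  filter_upwards [(Filter.eventually_all_finite (Set.finite_Iio N)).2 fun j _ => he (v j)] with i hi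
  exact hN true _ _ hi

/-- The restricted ultrapower is a `Σₙ₊₂`-elementary extension. -/
theorem Ultrapower.sigmaElem (h : ISigma S (n + 1))
    (he : ∀ a, ∀ᶠ i in (U : Filter S.M), A.rep (e.j a) i = a) : SigmaElem e (n + 2) := by
  have key : ∀ {P : (pairFam S A.K).Pred}, Hier (pairFam S A.K) true (n + 2) P →
      (∀ v, P true v → P false fun j => e.j (v j)) ∧
      ∀ v : ℕ → A.K.M, P false v → ∀ᶠ i in (U : Filter S.M), P true fun j => A.rep (v j) i := by
    intro P hP
    induction hP with
    | base hP =>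
      have hL := Hier.los h le_rfl hP
      exact ⟨fun v hv => (hL _).2 ((eventually_rep_emb he hP v).2 hv), fun v => (hL v).1⟩
    | @quant P _ ih =>
      refine ⟨fun v ⟨m, hm⟩ => ⟨e.j m, ?_⟩, fun v ⟨m, hm⟩ => (ih.2 _ hm).mono fun i hi => ?_⟩
      · exact (congrArg (P false) (comp_vcons e.j m v)).mp (ih.1 _ hm)
      · exact ⟨A.rep m i, (congrArg (P true) (comp_vcons (fun x => A.rep x i) m v)).mp hi⟩
  intro φ hφ v
  have hP : Hier (pairFam S A.K) true (n + 2) fun i v => Sat0 ((pairFam S A.K).str i) v φ :=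
    .of_isSigma hφ
  exact ⟨(key hP).1 v, fun hv => (eventually_rep_emb he hP v).1 ((key hP).2 _ hv)⟩

theorem Ultrapower.miSigma (h : ISigma S (n + 1)) (hU : Generic S q n U)
    (he : ∀ a, ∀ᶠ i in (U : Filter S.M), A.rep (e.j a) i = a) : MISigma e (n + 1) := by
  intro φ hφ v x a h0 hs m hm
  have hlt : ∀ {y : A.K.M}, A.K.lt y (e.j a) → ∃ c, S.lt c a ∧ e.j c = y := fun hy => by
    refine exists_eq_of_lt h.1 hU he ?_
    filter_upwards [(A.lt_iff _ _).1 hy, he a] with i h₁ h₂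
    rwa [h₂] at h₁
  have hP : Hier (pairFam S A.K) true (n + 1)
      fun i w => Sat0 ((pairFam S A.K).str i) (upd (fun j => w (j + 1)) x (w 0)) φ :=
    (Hier.of_isSigma (F := pairFam S A.K) hφ).subst (.updVar x)
  have key : ∀ c, Sat0 A.K (upd v x (e.j c)) φ ↔ ∀ᶠ i in (U : Filter S.M),
      Sat0 S (upd (fun j => A.rep (v j) i) x c) φ := fun c =>
    (Hier.los h le_rfl hP).imp_eventually (m := e.j c) (v := v) |>.trans <|
      Filter.eventually_congr <| (he c).mono fun i hi => by
        rw [hi]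
        exact Iff.rfl
  obtain ⟨c, hc, rfl⟩ := hlt hm
  rw [key]
  refine hU.induction' (Hier.restrict hP) (fun j => A.rep_def (v j)) a ?_ (fun y hy hyi => ?_) c hc
  · rw [← e.zero] at h0
    exact (key _).1 h0
  · have := hs (e.j y) ((e.lt_iff _ _).1 hy) ((key y).2 hyi)
    rw [← e.one, ← e.add] at this
    exact (key _).1 this

theorem ISigma.exists_endExt (h : ISigma S (n + 2)) (hc : Countable S.M) :
    ∃ (K : Str) (e : Emb S K),
      IsProper e ∧ IsEndExt e ∧ SigmaElem e (n + 2) ∧ MISigma e (n + 1) := by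
  have : Nonempty S.M := ⟨S.zero⟩
  obtain ⟨q, hq⟩ := exists_surjective_nat S.M
  obtain ⟨U, hU⟩ := h.exists_generic hq
  obtain ⟨A⟩ := nonempty_ultrapower S q n U hq
  obtain ⟨e, he⟩ := A.exists_emb hq
  exact ⟨A.K, e, A.isProper h.1 hU he, A.isEndExt h.1 hU he, A.sigmaElem h.of_succ he,
    A.miSigma h.of_succ hU he⟩

end Extension

/-- Theorem `thm:paris-kirby-ind`.
Let `M` be a countable model of `IΔ₀`.  For each `n ∈ ℕ`, `M ⊨ IΣₙ₊₂` iff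
`M` admits a proper `Σₙ₊₂`-elementary end extension `K` with
`K ⊨ M‑IΣₙ₊₁`. -/
theorem statement_19 (n : ℕ) (S : Str) (hc : Countable S.M)
    (hS : IDelta0 S) :
    ISigma S (n + 2) ↔
      ∃ (K : Str) (e : Emb S K),
        IsProper e ∧ IsEndExt e ∧ SigmaElem e (n + 2) ∧ MISigma e (n + 1) := by
  exact ⟨fun h => h.exists_endExt hc,
    fun ⟨_, _, hp, hE, he, hM⟩ => iSigma_of_endExt hS.1 hp hE he hM⟩

end PaperArith
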